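/- arXiv:1102.1480 — 11 statements merged into one kernel-verified Lean document; each statement's English description precedes it below -/
import Mathlib

section
/- Let N ≥ 1, let L ⊆ {1,…,N}, and let c ∈ {0,1}^N. Then c satisfies the inequality Σ_{i∈S} c_i − Σ_{i∈L∖S} c_i ≤ |S| − 1 for every subset S ⊆ L of odd cardinality if and only if Σ_{i∈L} c_i is even. -/
/-- For `c ∈ {0,1}^N` and `L ⊆ {1,…,N}`, the local-codeword-polytope
inequalities `∑_{i∈S} c_i − ∑_{i∈L∖S} c_i ≤ |S| − 1` hold for every odd-cardinality
`S ⊆ L` iff `∑_{i∈L} c_i` is even. -/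
theorem stmt_0 (N : ℕ) (hN : 1 ≤ N) (L : Finset (Fin N)) (c : Fin N → ℤ)
    (hc : ∀ i, c i = 0 ∨ c i = 1) :
    (∀ S ⊆ L, Odd S.card →
      ∑ i ∈ S, c i - ∑ i ∈ L \ S, c i ≤ (S.card : ℤ) - 1) ↔
    Even (∑ i ∈ L, c i) := by
  constructor
  · intro h
    by_contra hodd
    rw [Int.not_even_iff_odd] at hodd
    have hsub : L.filter (fun i => c i = 1) ⊆ L := Finset.filter_subset _ _
    have h1 : ∑ i ∈ L.filter (fun i => c i = 1), c i
        = ((L.filter (fun i => c i = 1)).card : ℤ) := by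
      rw [Finset.sum_congr rfl (g := fun _ => (1 : ℤ))
        (fun i hi => (Finset.mem_filter.mp hi).2)]
      simp
    have h0 : ∑ i ∈ L \ L.filter (fun i => c i = 1), c i = 0 := by
      apply Finset.sum_eq_zero
      intro i hi
      rw [Finset.mem_sdiff, Finset.mem_filter] at hi
      rcases hc i with h' | h'
      · exact h'
      · exact absurd ⟨hi.1, h'⟩ hi.2
    have hs := Finset.sum_sdiff (f := c) hsub
    rw [h0, h1, zero_add] at hs
    rw [← hs] at hodd
    have := h _ hsub (by exact_mod_cast hodd)
    rw [h0, h1] at this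
    linarith
  · intro he S hS hodd
    by_contra hlt
    have h1 : ∑ i ∈ S, c i ≤ (S.card : ℤ) := by
      have : ∑ i ∈ S, c i ≤ ∑ i ∈ S, (1 : ℤ) :=
        Finset.sum_le_sum (fun i _ => by rcases hc i with h | h <;> simp [h])
      simpa using this
    have h0 : 0 ≤ ∑ i ∈ L \ S, c i :=
      Finset.sum_nonneg (fun i _ => by rcases hc i with h | h <;> simp [h])
    have hs := Finset.sum_sdiff (f := c) hS
    have heq : ∑ i ∈ L, c i = (S.card : ℤ) := by omega
    rw [heq] at he
    have he' : Even S.card := by exact_mod_cast he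
    exact (Nat.not_even_iff_odd.mpr hodd) he'
end

section
/- Let a binary linear code of length N be given by a finite collection 𝓛 of parity checks, each a subset L ⊆ {1,…,N}, with code C = {c ∈ {0,1}^N : Σ_{i∈L} c_i is even for all L ∈ 𝓛}, and let P(H) be the relaxed polytope of all f ∈ [0,1]^N such that for every L ∈ 𝓛 and every S ⊆ L with |S| odd, Σ_{i∈S} f_i − Σ_{i∈L∖S} f_i ≤ |S| − 1. Then (i) P(H) ∩ {0,1}^N = C (in particular C ⊆ P(H)); and (ii) for any cost vector λ ∈ ℝ^N, if f* minimizes Σ_{i=1}^N λ_i f_i over P(H) and f* ∈ {0,1}^N, then f* ∈ C and Σ_i λ_i f*_i ≤ Σ_i λ_i c_i for every c ∈ C (the ML certificate property of the LP decoder). -/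
theorem aux_sum {N : ℕ} (f : Fin N → ℝ) (hf : ∀ i, f i = 0 ∨ f i = 1) (A : Finset (Fin N)) :
    ∑ i ∈ A, f i = ((A.filter (fun i => f i = 1)).card : ℝ) := by
  rw [Finset.card_filter]
  push_cast
  refine Finset.sum_congr rfl fun i _ => ?_
  rcases hf i with h | h <;> simp [h]

theorem aux_check {N : ℕ} (f : Fin N → ℝ) (hf : ∀ i, f i = 0 ∨ f i = 1) (L : Finset (Fin N)) :
    (∀ S ⊆ L, Odd S.card → ∑ i ∈ S, f i - ∑ i ∈ L \ S, f i ≤ (S.card : ℝ) - 1) ↔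
      ∃ k : ℤ, ∑ i ∈ L, f i = 2 * (k : ℝ) := by
  constructor
  · intro h
    rcases Nat.even_or_odd (L.filter (fun i => f i = 1)).card with he | ho
    · obtain ⟨k, hk⟩ := he
      refine ⟨k, ?_⟩
      rw [aux_sum f hf, hk]
      push_cast
      ring
    · exfalso
      have h1 := h _ (Finset.filter_subset _ _) ho
      have h2 := Finset.sum_sdiff (f := f) (Finset.filter_subset (fun i => f i = 1) L)
      have h3 := aux_sum f hf L
      have h4 := aux_sum f hf (L.filter (fun i => f i = 1))
      rw [Finset.filter_filter] at h4
      simp only [and_self] at h4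
      linarith
  · rintro ⟨k, hk⟩ S hS ho
    have h2 := Finset.sum_sdiff (f := f) hS
    have h5 : (S.filter (fun i => f i = 1)).card ≤ S.card := Finset.card_filter_le _ _
    rw [← h2] at hk
    rw [aux_sum f hf S, aux_sum f hf (L \ S)] at *
    generalize (S.filter (fun i => f i = 1)).card = a at *
    generalize ((L \ S).filter (fun i => f i = 1)).card = b at *
    generalize S.card = s at *
    have hk' : (b : ℤ) + a = 2 * k := by exact_mod_cast hk
    obtain ⟨m, hm⟩ := ho
    have : (a : ℤ) - b ≤ s - 1 := by omega
    exact_mod_cast this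

/-- the 0/1 points of the relaxed polytope `P(H)` are exactly the
codewords, and the LP decoder has the ML certificate property. -/
theorem stmt_1 (N : ℕ) (hN : 1 ≤ N) (𝓛 : Finset (Finset (Fin N)))
    (C : Set (Fin N → ℝ))
    (hC : C = {c | (∀ i, c i = 0 ∨ c i = 1) ∧
      ∀ L ∈ 𝓛, ∃ k : ℤ, ∑ i ∈ L, c i = 2 * (k : ℝ)})
    (PH : Set (Fin N → ℝ))
    (hPH : PH = {f | (∀ i, 0 ≤ f i ∧ f i ≤ 1) ∧
      ∀ L ∈ 𝓛, ∀ S ⊆ L, Odd S.card →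
        ∑ i ∈ S, f i - ∑ i ∈ L \ S, f i ≤ (S.card : ℝ) - 1}) :
    ({f ∈ PH | ∀ i, f i = 0 ∨ f i = 1} = C) ∧
    (∀ lam fstar : Fin N → ℝ,
      fstar ∈ PH → (∀ f ∈ PH, ∑ i, lam i * fstar i ≤ ∑ i, lam i * f i) →
      (∀ i, fstar i = 0 ∨ fstar i = 1) →
      fstar ∈ C ∧ ∀ c ∈ C, ∑ i, lam i * fstar i ≤ ∑ i, lam i * c i) := by
  have key : {f ∈ PH | ∀ i, f i = 0 ∨ f i = 1} = C := by
    subst hC hPH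
    ext f
    simp only [Set.mem_setOf_eq]
    constructor
    · rintro ⟨⟨_, h⟩, hf⟩
      exact ⟨hf, fun L hL => (aux_check f hf L).1 (h L hL)⟩
    · rintro ⟨hf, h⟩
      refine ⟨⟨fun i => ?_, fun L hL => (aux_check f hf L).2 (h L hL)⟩, hf⟩
      rcases hf i with h | h <;> simp [h]
  refine ⟨key, fun lam fstar hP hmin h01 => ⟨?_, fun c hc => ?_⟩⟩
  · rw [← key]
    exact ⟨hP, h01⟩
  · rw [← key] at hc
    exact hmin c hc.1
end

section
/- Let g belong to the trellis polytope 𝒯 and suppose every entry g_{i,e} ∈ {0,1}. Then for each time i ∈ {1,…,N} there is exactly one edge e_i ∈ E with g_{i,e_i} = 1, and these edges form an edge path, i.e., s'(e_i) = s(e_{i+1}) for all 1 ≤ i ≤ N−1. -/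
/-- an integral point of the trellis polytope selects exactly one edge
per time step, and those edges form an edge path. -/
theorem stmt_2 {S E : Type*} [Fintype S] [DecidableEq S] [Fintype E]
    (N p : ℕ) (hN : 1 ≤ N) (hp : p ∈ Finset.Icc 1 N)
    (s s' : E → S) (g : ℕ → E → ℝ)
    (hbox : ∀ i ∈ Finset.Icc 1 N, ∀ e : E, 0 ≤ g i e ∧ g i e ≤ 1)
    (hflow : ∀ i ∈ Finset.Icc 1 (N - 1), ∀ k : S,
      ∑ e ∈ Finset.univ.filter (fun e => s' e = k), g i e
        = ∑ e ∈ Finset.univ.filter (fun e => s e = k), g (i + 1) e)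
    (hnorm : ∑ e : E, g p e = 1)
    (hint : ∀ i ∈ Finset.Icc 1 N, ∀ e : E, g i e = 0 ∨ g i e = 1) :
    ∃ ep : ℕ → E,
      (∀ i ∈ Finset.Icc 1 N, ∀ e : E, g i e = 1 ↔ e = ep i) ∧
      (∀ i ∈ Finset.Icc 1 (N - 1), s' (ep i) = s (ep (i + 1))) := by
  classical
  have hstep : ∀ i ∈ Finset.Icc 1 (N - 1), ∑ e : E, g i e = ∑ e : E, g (i + 1) e := by
    intro i hi
    rw [← Finset.sum_fiberwise Finset.univ s' (g i),
      ← Finset.sum_fiberwise Finset.univ s (g (i + 1))]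
    exact Finset.sum_congr rfl fun k _ => hflow i hi k
  have hall : ∀ i, 1 ≤ i → i ≤ N → ∑ e : E, g i e = ∑ e : E, g 1 e := by
    intro i h1
    induction i, h1 using Nat.le_induction with
    | base => intro _; rfl
    | succ i h1 ih =>
      intro h
      rw [← hstep i (Finset.mem_Icc.2 ⟨h1, by omega⟩)]
      exact ih (by omega)
  have hone : ∀ i ∈ Finset.Icc 1 N, ∑ e : E, g i e = 1 := by
    intro i hi
    rw [Finset.mem_Icc] at hi hp
    rw [hall i hi.1 hi.2, ← hall p hp.1 hp.2, hnorm]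
  have hex : ∀ i ∈ Finset.Icc 1 N, ∃ a : E, ∀ e : E, g i e = 1 ↔ e = a := by
    intro i hi
    have h1 := hone i hi
    obtain ⟨a, ha⟩ : ∃ a, g i a = 1 := by
      by_contra hc
      push Not at hc
      rw [Finset.sum_eq_zero fun e _ => (hint i hi e).resolve_right (hc e)] at h1
      exact zero_ne_one h1
    refine ⟨a, fun e => ⟨fun he => ?_, fun he => he ▸ ha⟩⟩
    by_contra hne
    have h2 : ∑ x ∈ ({e, a} : Finset E), g i x ≤ ∑ x : E, g i x :=
      Finset.sum_le_sum_of_subset_of_nonneg (Finset.subset_univ _)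
        fun x _ _ => (hbox i hi x).1
    rw [Finset.sum_pair hne, he, ha, h1] at h2
    norm_num at h2
  obtain ⟨a0, _⟩ := hex p hp
  haveI : Nonempty E := ⟨a0⟩
  choose! ep hep using hex
  refine ⟨ep, hep, fun i hi => ?_⟩
  have hi' := Finset.mem_Icc.1 hi
  have hiN : i ∈ Finset.Icc 1 N := Finset.mem_Icc.2 ⟨hi'.1, by omega⟩
  have hiN' : i + 1 ∈ Finset.Icc 1 N := Finset.mem_Icc.2 ⟨by omega, by omega⟩
  by_contra hne
  have h := hflow i hi (s' (ep i))
  have hR : ∑ e ∈ Finset.univ.filter (fun e => s e = s' (ep i)), g (i + 1) e = 0 := by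
    refine Finset.sum_eq_zero fun e he => (hint _ hiN' e).resolve_right fun h1 => hne ?_
    rw [← (hep _ hiN' e).1 h1]
    exact (Finset.mem_filter.1 he).2.symm
  have hL : g i (ep i) ≤ ∑ e ∈ Finset.univ.filter (fun e => s' e = s' (ep i)), g i e :=
    Finset.single_le_sum (fun x _ => (hbox i hiN x).1) (by simp)
  rw [h, hR, (hep i hiN (ep i)).2 rfl] at hL
  norm_num at hL
end

section
/- Suppose the trellis polytope 𝒯 is nonempty. Then for every cost assignment b : {1,…,N} × E → ℝ, the linear function g ↦ Σ_{i=1}^N Σ_{e∈E} b_{i,e} g_{i,e} attains its minimum over 𝒯 at a point g* all of whose entries lie in {0,1} (hence, by the characterization of integral points of 𝒯, at the indicator of an edge path; i.e., the minimum-cost-flow LP over the trellis finds a minimum-weight edge path). -/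
/-- Membership in the trellis polytope `𝒯`. -/
def MemTrellis {S E : Type*} [Fintype S] [DecidableEq S] [Fintype E]
    (N p : ℕ) (s s' : E → S) (g : ℕ → E → ℝ) : Prop :=
  (∀ i ∈ Finset.Icc 1 N, ∀ e : E, 0 ≤ g i e ∧ g i e ≤ 1) ∧
  (∀ i ∈ Finset.Icc 1 (N - 1), ∀ k : S,
    ∑ e ∈ Finset.univ.filter (fun e => s' e = k), g i e
      = ∑ e ∈ Finset.univ.filter (fun e => s e = k), g (i + 1) e) ∧
  ∑ e : E, g p e = 1

/-- Any nonnegative unit flow supports an edge path whose cost is at most the cost of the flow. -/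
theorem exists_path_le {S E : Type*} [Fintype S] [DecidableEq S] [Fintype E]
    (s s' : E → S) (g : ℕ → E → ℝ) (hm : ∑ e : E, g 1 e = 1) (n : ℕ) :
    (∀ i ∈ Finset.Icc 1 (n + 1), ∀ e : E, 0 ≤ g i e) →
    (∀ i ∈ Finset.Icc 1 n, ∀ k : S,
      ∑ e ∈ Finset.univ.filter (fun e => s' e = k), g i e
        = ∑ e ∈ Finset.univ.filter (fun e => s e = k), g (i + 1) e) →
    ∀ b : ℕ → E → ℝ, ∃ e : ℕ → E, (∀ i ∈ Finset.Icc 1 (n + 1), 0 < g i (e i)) ∧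
      (∀ i ∈ Finset.Icc 1 n, s' (e i) = s (e (i + 1))) ∧
      ∑ i ∈ Finset.Icc 1 (n + 1), b i (e i) ≤ ∑ i ∈ Finset.Icc 1 (n + 1), ∑ x : E, b i x * g i x := by
  classical
  induction n with
  | zero =>
    intro h0 _ b
    have h0' : ∀ e, 0 ≤ g 1 e := h0 1 (by simp)
    have hne : (Finset.univ.filter (fun e => 0 < g 1 e)).Nonempty := by
      by_contra hcon
      rw [Finset.not_nonempty_iff_eq_empty, Finset.filter_eq_empty_iff] at hcon
      have : ∑ e : E, g 1 e ≤ 0 := Finset.sum_nonpos (fun e he => not_lt.1 (hcon he))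
      linarith
    obtain ⟨x, hx, hmin⟩ := Finset.exists_min_image _ (b 1) hne
    refine ⟨fun _ => x, ?_, by simp, ?_⟩
    · intro i hi
      obtain rfl : i = 1 := by simpa using hi
      simpa using hx
    · simp only [zero_add, Finset.Icc_self, Finset.sum_singleton]
      calc b 1 x = ∑ y, b 1 x * g 1 y := by rw [← Finset.mul_sum, hm, mul_one]
        _ ≤ _ := by
          refine Finset.sum_le_sum fun y _ => ?_
          rcases (h0' y).eq_or_lt with h | h
          · simp [← h]
          · exact mul_le_mul_of_nonneg_right (hmin y (by simpa using h)) h.le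
  | succ n ih =>
    intro h0 hf b
    have hl : ∀ e, 0 ≤ g (n + 1 + 1) e := h0 (n + 1 + 1) (by simp)
    -- cheapest continuation from each state that has one
    have hψ : ∀ k : S, ∃ v : ℝ, (∀ y, s y = k → 0 < g (n + 1 + 1) y → v ≤ b (n + 1 + 1) y) ∧
        ((∃ y, s y = k ∧ 0 < g (n + 1 + 1) y) →
          ∃ y, s y = k ∧ 0 < g (n + 1 + 1) y ∧ v = b (n + 1 + 1) y) := by
      intro k
      by_cases hk : (Finset.univ.filter (fun y => s y = k ∧ 0 < g (n + 1 + 1) y)).Nonempty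
      · obtain ⟨x, hx, hmin⟩ := Finset.exists_min_image _ (b (n + 1 + 1)) hk
        simp only [Finset.mem_filter, Finset.mem_univ, true_and] at hx hmin
        exact ⟨b (n + 1 + 1) x, fun y h1 h2 => hmin y ⟨h1, h2⟩, fun _ => ⟨x, hx.1, hx.2, rfl⟩⟩
      · have hk' : ¬ ∃ y, s y = k ∧ 0 < g (n + 1 + 1) y := by
          rintro ⟨y, hy⟩
          exact hk ⟨y, by simpa using hy⟩
        exact ⟨0, fun y h1 h2 => (hk' ⟨y, h1, h2⟩).elim, fun h => (hk' h).elim⟩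
    choose ψ hψ1 hψ2 using hψ
    obtain ⟨e, he1, he2, he3⟩ := ih
      (fun i hi => h0 i (by simp only [Finset.mem_Icc] at hi ⊢; omega))
      (fun i hi => hf i (by simp only [Finset.mem_Icc] at hi ⊢; omega))
      (fun i x => b i x + if i = n + 1 then ψ (s' x) else 0)
    have hfl := hf (n + 1) (by simp)
    have hex : ∃ y, s y = s' (e (n + 1)) ∧ 0 < g (n + 1 + 1) y := by
      by_contra hcon
      push Not at hcon
      have h1 : 0 < ∑ x ∈ Finset.univ.filter (fun x => s' x = s' (e (n + 1))), g (n + 1) x :=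
        Finset.sum_pos' (fun x _ => h0 (n + 1) (by simp) x)
          ⟨e (n + 1), by simp, he1 (n + 1) (by simp)⟩
      rw [hfl] at h1
      have h2 : ∑ x ∈ Finset.univ.filter (fun x => s x = s' (e (n + 1))), g (n + 1 + 1) x ≤ 0 :=
        Finset.sum_nonpos (fun x hx => hcon x (by simpa using hx))
      linarith
    obtain ⟨y, hy1, hy2, hy3⟩ := hψ2 _ hex
    refine ⟨Function.update e (n + 1 + 1) y, ?_, ?_, ?_⟩
    · intro i hi
      by_cases h : i = n + 1 + 1
      · subst h; simpa using hy2
      · rw [Function.update_of_ne h]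
        exact he1 i (by simp only [Finset.mem_Icc] at hi ⊢; omega)
    · intro i hi
      simp only [Finset.mem_Icc] at hi
      rw [Function.update_of_ne (by omega)]
      by_cases h : i = n + 1
      · subst h; simpa using hy1.symm
      · rw [Function.update_of_ne (by omega)]
        exact he2 i (by simp only [Finset.mem_Icc]; omega)
    · rw [Finset.sum_Icc_succ_top (by omega), Finset.sum_Icc_succ_top (b := n + 1) (by omega)]
      have hA : ∑ i ∈ Finset.Icc 1 (n + 1), b i (Function.update e (n + 1 + 1) y i)
          = ∑ i ∈ Finset.Icc 1 (n + 1), b i (e i) := by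
        refine Finset.sum_congr rfl fun i hi => ?_
        simp only [Finset.mem_Icc] at hi
        rw [Function.update_of_ne (by omega)]
      rw [hA, Function.update_self, ← hy3]
      have hB : ∑ i ∈ Finset.Icc 1 (n + 1), (b i (e i) + if i = n + 1 then ψ (s' (e i)) else 0)
          = ∑ i ∈ Finset.Icc 1 (n + 1), b i (e i) + ψ (s' (e (n + 1))) := by
        rw [Finset.sum_add_distrib, Finset.sum_ite_eq_of_mem' _ _ _ (by simp)]
      have hC : ∑ i ∈ Finset.Icc 1 (n + 1), ∑ x : E,
            (b i x + if i = n + 1 then ψ (s' x) else 0) * g i x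
          = ∑ i ∈ Finset.Icc 1 (n + 1), ∑ x : E, b i x * g i x
            + ∑ x, ψ (s' x) * g (n + 1) x := by
        rw [← Finset.sum_ite_eq_of_mem' (Finset.Icc 1 (n + 1)) (n + 1)
          (fun i => ∑ x, ψ (s' x) * g i x) (by simp), ← Finset.sum_add_distrib]
        refine Finset.sum_congr rfl fun i _ => ?_
        split_ifs
        · rw [← Finset.sum_add_distrib]
          exact Finset.sum_congr rfl fun x _ => by ring
        · simp
      have hD : ∑ x, ψ (s' x) * g (n + 1) x = ∑ x, ψ (s x) * g (n + 1 + 1) x := by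
        rw [← Finset.sum_fiberwise Finset.univ s', ← Finset.sum_fiberwise Finset.univ s]
        refine Finset.sum_congr rfl fun k _ => ?_
        have e1 : ∑ x ∈ Finset.univ.filter (fun x => s' x = k), ψ (s' x) * g (n + 1) x
            = ψ k * ∑ x ∈ Finset.univ.filter (fun x => s' x = k), g (n + 1) x := by
          rw [Finset.mul_sum]
          refine Finset.sum_congr rfl fun x hx => ?_
          rw [(Finset.mem_filter.1 hx).2]
        have e2 : ∑ x ∈ Finset.univ.filter (fun x => s x = k), ψ (s x) * g (n + 1 + 1) x
            = ψ k * ∑ x ∈ Finset.univ.filter (fun x => s x = k), g (n + 1 + 1) x := by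
          rw [Finset.mul_sum]
          refine Finset.sum_congr rfl fun x hx => ?_
          rw [(Finset.mem_filter.1 hx).2]
        rw [e1, e2, hfl]
      have hE : ∑ x, ψ (s x) * g (n + 1 + 1) x ≤ ∑ x, b (n + 1 + 1) x * g (n + 1 + 1) x := by
        refine Finset.sum_le_sum fun x _ => ?_
        rcases (hl x).eq_or_lt with h | h
        · simp [← h]
        · exact mul_le_mul_of_nonneg_right (hψ1 _ x rfl h) h.le
      rw [hB, hC, hD] at he3
      linarith

/-- if the trellis polytope is nonempty, then every linear cost attains
its minimum over it at an integral (0/1) point. -/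
theorem stmt_3 {S E : Type*} [Fintype S] [DecidableEq S] [Fintype E]
    (N p : ℕ) (hN : 1 ≤ N) (hp : p ∈ Finset.Icc 1 N)
    (s s' : E → S) (hne : ∃ g, MemTrellis N p s s' g) (b : ℕ → E → ℝ) :
    ∃ gstar, MemTrellis N p s s' gstar ∧
      (∀ i ∈ Finset.Icc 1 N, ∀ e : E, gstar i e = 0 ∨ gstar i e = 1) ∧
      ∀ g, MemTrellis N p s s' g →
        ∑ i ∈ Finset.Icc 1 N, ∑ e : E, b i e * gstar i e
          ≤ ∑ i ∈ Finset.Icc 1 N, ∑ e : E, b i e * g i e := by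
  classical
  obtain ⟨n, rfl⟩ : ∃ n, N = n + 1 := ⟨N - 1, by omega⟩
  have key : ∀ g, MemTrellis (n + 1) p s s' g → ∃ e : ℕ → E,
      (∀ i ∈ Finset.Icc 1 n, s' (e i) = s (e (i + 1))) ∧
      ∑ i ∈ Finset.Icc 1 (n + 1), b i (e i)
        ≤ ∑ i ∈ Finset.Icc 1 (n + 1), ∑ x : E, b i x * g i x := by
    rintro g ⟨h1, h2, h3⟩
    rw [Nat.add_sub_cancel] at h2
    have hmass : ∀ i, i + 1 ∈ Finset.Icc 1 (n + 1) → ∑ x, g (i + 1) x = ∑ x, g 1 x := by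
      intro i
      induction i with
      | zero => simp
      | succ i ih =>
        intro hi
        simp only [Finset.mem_Icc] at hi ih
        rw [← ih (by omega), ← Finset.sum_fiberwise Finset.univ s,
          ← Finset.sum_fiberwise Finset.univ s' (g (i + 1))]
        exact Finset.sum_congr rfl fun k _ =>
          (h2 (i + 1) (by simp only [Finset.mem_Icc]; omega) k).symm
    have hm : ∑ x, g 1 x = 1 := by
      obtain ⟨q, rfl⟩ : ∃ q, p = q + 1 := ⟨p - 1, by simp only [Finset.mem_Icc] at hp; omega⟩
      rw [← hmass q hp, h3]
    obtain ⟨e, -, he2, he3⟩ := exists_path_le s s' g hm n (fun i hi x => (h1 i hi x).1) h2 b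
    exact ⟨e, he2, he3⟩
  set C : Set ℝ := {c | ∃ e : ℕ → E, (∀ i ∈ Finset.Icc 1 n, s' (e i) = s (e (i + 1))) ∧
    ∑ i ∈ Finset.Icc 1 (n + 1), b i (e i) = c} with hC
  have hfin : C.Finite := by
    refine (Set.finite_range (fun f : Finset.Icc 1 (n + 1) → E =>
      ∑ i : Finset.Icc 1 (n + 1), b i (f i))).subset ?_
    rintro c ⟨e, -, rfl⟩
    exact ⟨fun i => e i, Finset.sum_coe_sort (Finset.Icc 1 (n + 1)) (fun i => b i (e i))⟩
  have hCne : C.Nonempty := by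
    obtain ⟨g, hg⟩ := hne
    obtain ⟨e, he, -⟩ := key g hg
    exact ⟨_, e, he, rfl⟩
  obtain ⟨c, ⟨e, he, rfl⟩, hmin⟩ := Set.exists_min_image C id hfin hCne
  refine ⟨fun i x => if x = e i then 1 else 0, ⟨?_, ?_, ?_⟩, ?_, ?_⟩
  · intro i _ x
    dsimp only
    split_ifs <;> norm_num
  · intro i hi k
    rw [Nat.add_sub_cancel] at hi
    simp [Finset.sum_ite_eq', he i hi]
  · simp
  · intro i _ x
    dsimp only
    split_ifs <;> simp
  · intro g hg
    obtain ⟨e', he', hle⟩ := key g hg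
    have := hmin _ ⟨e', he', rfl⟩
    simp only [id] at this
    simpa using this.trans hle
end

section
/- Give the trellis an input label x : E → {0,1} and let C and P(H) be a binary linear code of length N and its relaxed polytope. Let P_{i,e} > 0 be positive reals and set branch metrics b_{i,e} = −ln P_{i,e}. Suppose g* minimizes Σ_{i=1}^N Σ_{e∈E} b_{i,e} g_{i,e} over P_𝒯(H) and every entry of g* lies in {0,1}. Then for each i there is a unique e_i with g*_{i,e_i} = 1, the sequence (e_1,…,e_N) is an edge path whose label sequence (x(e_1),…,x(e_N)) is a codeword of C, and for every edge path (e'_1,…,e'_N) whose label sequence is a codeword of C, Π_{i=1}^N P_{i,e_i} ≥ Π_{i=1}^N P_{i,e'_i}. In other words, an integral optimum of the joint LP decoder is a joint maximum-likelihood edge path. -/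
/-- Membership in the code `C` given by the parity checks `𝓛` (bits indexed `1,…,N`). -/
def MemCode (N : ℕ) (𝓛 : Finset (Finset ℕ)) (c : ℕ → ℝ) : Prop :=
  (∀ i ∈ Finset.Icc 1 N, c i = 0 ∨ c i = 1) ∧
  ∀ L ∈ 𝓛, ∃ k : ℤ, ∑ i ∈ L, c i = 2 * (k : ℝ)

/-- Membership in the relaxed codeword polytope `P(H)`. -/
def MemRelaxed (N : ℕ) (𝓛 : Finset (Finset ℕ)) (f : ℕ → ℝ) : Prop :=
  (∀ i ∈ Finset.Icc 1 N, 0 ≤ f i ∧ f i ≤ 1) ∧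
  ∀ L ∈ 𝓛, ∀ T ⊆ L, Odd T.card →
    ∑ i ∈ T, f i - ∑ i ∈ L \ T, f i ≤ (T.card : ℝ) - 1

/-- Membership in the relaxed joint polytope `P_𝒯(H) = {g ∈ 𝒯 : Q(g) ∈ P(H)}`,
where `Q(g)_i = Σ_{e : x(e)=1} g_{i,e} = Σ_e g_{i,e}·x(e)` for a 0/1 label `x`. -/
def MemJoint {S E : Type*} [Fintype S] [DecidableEq S] [Fintype E]
    (N p : ℕ) (s s' : E → S) (x : E → ℝ) (𝓛 : Finset (Finset ℕ))
    (g : ℕ → E → ℝ) : Prop :=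
  MemTrellis N p s s' g ∧ MemRelaxed N 𝓛 (fun i => ∑ e : E, g i e * x e)

theorem code_to_relaxed (N : ℕ) (𝓛 : Finset (Finset ℕ)) (h𝓛 : ∀ L ∈ 𝓛, L ⊆ Finset.Icc 1 N)
    (c : ℕ → ℝ) (h : MemCode N 𝓛 c) : MemRelaxed N 𝓛 c := by
  obtain ⟨h01, hpar⟩ := h
  refine ⟨fun i hi => by rcases h01 i hi with h | h <;> rw [h] <;> norm_num, ?_⟩
  intro L hL T hT hodd
  obtain ⟨k, hk⟩ := hpar L hL
  have hint : ∀ i ∈ L \ T, c i = ((if c i = 1 then 1 else 0 : ℤ) : ℝ) := by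
    intro i hi
    rcases h01 i (h𝓛 L hL (Finset.mem_sdiff.1 hi).1) with h | h <;> simp [h]
  have hm := Finset.sum_congr rfl hint
  rw [← Int.cast_sum] at hm
  set m : ℤ := ∑ i ∈ L \ T, (if c i = 1 then 1 else 0 : ℤ)
  have hle : ∑ i ∈ T, c i ≤ (T.card : ℝ) := by
    have := Finset.sum_le_card_nsmul T c 1 (fun i hi => by
      rcases h01 i (h𝓛 L hL (hT hi)) with h | h <;> rw [h] <;> norm_num)
    simpa using this
  have hs := Finset.sum_sdiff (f := c) hT
  have hm0 : (0 : ℝ) ≤ ∑ i ∈ L \ T, c i := Finset.sum_nonneg (fun i hi => by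
    rcases h01 i (h𝓛 L hL (Finset.mem_sdiff.1 hi).1) with h | h <;> rw [h] <;> norm_num)
  have e : ∑ i ∈ T, c i - ∑ i ∈ L \ T, c i = ((2 * k - 2 * m : ℤ) : ℝ) := by
    push_cast
    linarith
  have hz : ((2 * k - 2 * m : ℤ) : ℝ) ≤ ((T.card : ℤ) : ℝ) := by
    rw [← e]; push_cast; linarith
  have hz' : 2 * k - 2 * m ≤ (T.card : ℤ) := by exact_mod_cast hz
  obtain ⟨r, hr⟩ := hodd
  have hz2 : 2 * k - 2 * m ≤ (T.card : ℤ) - 1 := by omega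
  rw [e]
  exact_mod_cast hz2

theorem relaxed_to_code (N : ℕ) (𝓛 : Finset (Finset ℕ)) (h𝓛 : ∀ L ∈ 𝓛, L ⊆ Finset.Icc 1 N)
    (c : ℕ → ℝ) (h01 : ∀ i ∈ Finset.Icc 1 N, c i = 0 ∨ c i = 1)
    (h : MemRelaxed N 𝓛 c) : MemCode N 𝓛 c := by
  classical
  refine ⟨h01, fun L hL => ?_⟩
  set T := L.filter (fun i => c i = 1) with hTdef
  have hT : T ⊆ L := Finset.filter_subset _ _
  have h1 : ∑ i ∈ T, c i = (T.card : ℝ) := by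
    rw [Finset.sum_congr rfl (g := fun _ => (1 : ℝ)) (fun i hi => (Finset.mem_filter.1 hi).2)]
    simp [hTdef]
  have h0 : ∑ i ∈ L \ T, c i = 0 := by
    refine Finset.sum_eq_zero (fun i hi => ?_)
    obtain ⟨hiL, hiT⟩ := Finset.mem_sdiff.1 hi
    rcases h01 i (h𝓛 L hL hiL) with h | h
    · exact h
    · exact absurd (Finset.mem_filter.2 ⟨hiL, h⟩) hiT
  have hs := Finset.sum_sdiff (f := c) hT
  rcases Nat.even_or_odd T.card with he | ho
  · obtain ⟨r, hr⟩ := he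
    refine ⟨r, ?_⟩
    rw [← hs, h0, h1, hr]
    push_cast
    ring
  · have := h.2 L hL T hT ho
    rw [h0, h1] at this
    linarith

theorem sum_const_trellis {S E : Type*} [Fintype S] [DecidableEq S] [Fintype E]
    (N p : ℕ) (hp : p ∈ Finset.Icc 1 N) (s s' : E → S) (g : ℕ → E → ℝ)
    (h : MemTrellis N p s s' g) : ∀ i ∈ Finset.Icc 1 N, ∑ e : E, g i e = 1 := by
  obtain ⟨-, hflow, hnorm⟩ := h
  have step : ∀ i ∈ Finset.Icc 1 (N - 1), ∑ e : E, g i e = ∑ e : E, g (i + 1) e := by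
    intro i hi
    rw [← Finset.sum_fiberwise Finset.univ s' (g i),
      ← Finset.sum_fiberwise Finset.univ s (g (i + 1))]
    exact Finset.sum_congr rfl (fun k _ => hflow i hi k)
  have key : ∀ i, i + 1 ≤ N → ∑ e : E, g (i + 1) e = ∑ e : E, g 1 e := by
    intro i
    induction i with
    | zero => intro _; rfl
    | succ j ih =>
      intro hj
      rw [← step (j + 1) (Finset.mem_Icc.2 (by omega)), ih (by omega)]
  have key' : ∀ i ∈ Finset.Icc 1 N, ∑ e : E, g i e = ∑ e : E, g 1 e := by
    intro i hi
    rw [Finset.mem_Icc] at hi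
    have := key (i - 1) (by omega)
    rwa [Nat.sub_add_cancel hi.1] at this
  intro i hi
  rw [key' i hi, ← key' p hp, hnorm]

theorem exists_indicator {E : Type*} [Fintype E] (g : E → ℝ)
    (h01 : ∀ e, g e = 0 ∨ g e = 1) (hsum : ∑ e, g e = 1) :
    ∃ e0, ∀ e, g e = 1 ↔ e = e0 := by
  classical
  have hex : ∃ e0, g e0 = 1 := by
    by_contra hne
    push Not at hne
    rw [Finset.sum_eq_zero (fun e _ => (h01 e).resolve_right (hne e))] at hsum
    norm_num at hsum
  obtain ⟨e0, he0⟩ := hex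
  refine ⟨e0, fun e => ⟨fun he => ?_, fun he => he ▸ he0⟩⟩
  by_contra hne
  have hle : ∑ a ∈ ({e, e0} : Finset E), g a ≤ ∑ a, g a :=
    Finset.sum_le_sum_of_subset_of_nonneg (Finset.subset_univ _)
      (fun a _ _ => by rcases h01 a with h | h <;> rw [h] <;> norm_num)
  rw [Finset.sum_pair hne, hsum, he, he0] at hle
  norm_num at hle

/-- an integral optimum of the joint LP decoder is a joint
maximum-likelihood edge path whose label sequence is a codeword. -/
theorem stmt_4 {S E : Type*} [Fintype S] [DecidableEq S] [Fintype E]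
    (N p : ℕ) (hN : 1 ≤ N) (hp : p ∈ Finset.Icc 1 N)
    (s s' : E → S) (x : E → ℝ) (hx : ∀ e, x e = 0 ∨ x e = 1)
    (𝓛 : Finset (Finset ℕ)) (h𝓛 : ∀ L ∈ 𝓛, L ⊆ Finset.Icc 1 N)
    (P : ℕ → E → ℝ) (hP : ∀ i ∈ Finset.Icc 1 N, ∀ e : E, 0 < P i e)
    (b : ℕ → E → ℝ) (hb : ∀ i e, b i e = -Real.log (P i e))
    (gstar : ℕ → E → ℝ)
    (hmem : MemJoint N p s s' x 𝓛 gstar)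
    (hopt : ∀ g, MemJoint N p s s' x 𝓛 g →
      ∑ i ∈ Finset.Icc 1 N, ∑ e : E, b i e * gstar i e
        ≤ ∑ i ∈ Finset.Icc 1 N, ∑ e : E, b i e * g i e)
    (hint : ∀ i ∈ Finset.Icc 1 N, ∀ e : E, gstar i e = 0 ∨ gstar i e = 1) :
    ∃ ep : ℕ → E,
      (∀ i ∈ Finset.Icc 1 N, ∀ e : E, gstar i e = 1 ↔ e = ep i) ∧
      (∀ i ∈ Finset.Icc 1 (N - 1), s' (ep i) = s (ep (i + 1))) ∧
      MemCode N 𝓛 (fun i => x (ep i)) ∧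
      ∀ ep' : ℕ → E,
        (∀ i ∈ Finset.Icc 1 (N - 1), s' (ep' i) = s (ep' (i + 1))) →
        MemCode N 𝓛 (fun i => x (ep' i)) →
        ∏ i ∈ Finset.Icc 1 N, P i (ep' i) ≤ ∏ i ∈ Finset.Icc 1 N, P i (ep i) := by
  classical
  have hsum := sum_const_trellis N p hp s s' gstar hmem.1
  have hex : ∀ i ∈ Finset.Icc 1 N, ∃ e0, ∀ e, gstar i e = 1 ↔ e = e0 :=
    fun i hi => exists_indicator (gstar i) (hint i hi) (hsum i hi)
  obtain ⟨e1, -⟩ := hex p hp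
  have hex' : ∀ i, ∃ e0, i ∈ Finset.Icc 1 N → ∀ e, gstar i e = 1 ↔ e = e0 := by
    intro i
    by_cases hi : i ∈ Finset.Icc 1 N
    · obtain ⟨e0, h⟩ := hex i hi
      exact ⟨e0, fun _ => h⟩
    · exact ⟨e1, fun h => absurd h hi⟩
  choose ep hep using hex'
  have hg : ∀ i ∈ Finset.Icc 1 N, ∀ e, gstar i e = if e = ep i then 1 else 0 := by
    intro i hi e
    split_ifs with h
    · exact (hep i hi e).2 h
    · exact (hint i hi e).resolve_right (fun h' => h ((hep i hi e).1 h'))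
  refine ⟨ep, hep, ?_, ?_, ?_⟩
  · intro i hi
    have hi' := Finset.mem_Icc.1 hi
    have hf := hmem.1.2.1 i hi (s' (ep i))
    rw [Finset.sum_congr rfl (fun e _ => hg i (Finset.mem_Icc.2 (by omega)) e),
      Finset.sum_congr rfl (fun e _ => hg (i + 1) (Finset.mem_Icc.2 (by omega)) e)] at hf
    by_contra hne
    rw [Finset.sum_ite_eq', Finset.sum_ite_eq'] at hf
    simp [Ne.symm hne] at hf
  · refine relaxed_to_code N 𝓛 h𝓛 _ (fun i _ => hx _) ?_
    have hq : ∀ i ∈ Finset.Icc 1 N, ∑ e : E, gstar i e * x e = x (ep i) := by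
      intro i hi
      rw [Finset.sum_congr rfl (fun e _ => by rw [hg i hi e])]
      simp
    refine ⟨fun i hi => ?_, fun L hL T hT ho => ?_⟩
    · have := hmem.2.1 i hi
      simpa only [hq i hi] using this
    · have := hmem.2.2 L hL T hT ho
      rw [Finset.sum_congr rfl (fun i hi => hq i (h𝓛 L hL (hT hi))),
        Finset.sum_congr rfl
          (fun i hi => hq i (h𝓛 L hL (Finset.mem_sdiff.1 hi).1))] at this
      exact this
  · intro ep' hpath hcode
    have hmem' : MemJoint N p s s' x 𝓛 (fun i e => if e = ep' i then 1 else 0) := by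
      refine ⟨⟨fun i _ e => ?_, fun i hi k => ?_, ?_⟩, ?_⟩
      · dsimp only
        split_ifs <;> norm_num
      · rw [Finset.sum_ite_eq', Finset.sum_ite_eq']
        simp [hpath i hi]
      · simp
      · have := code_to_relaxed N 𝓛 h𝓛 _ hcode
        simpa using this
    have ho := hopt _ hmem'
    have e1 : ∑ i ∈ Finset.Icc 1 N, ∑ e : E, b i e * gstar i e
        = ∑ i ∈ Finset.Icc 1 N, -Real.log (P i (ep i)) := by
      refine Finset.sum_congr rfl (fun i hi => ?_)
      rw [Finset.sum_congr rfl (fun e _ => by rw [hg i hi e])]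
      simp [hb]
    have e2 : ∑ i ∈ Finset.Icc 1 N, ∑ e : E, b i e * (if e = ep' i then 1 else 0)
        = ∑ i ∈ Finset.Icc 1 N, -Real.log (P i (ep' i)) := by
      refine Finset.sum_congr rfl (fun i hi => ?_)
      simp [hb]
    rw [e1, e2, Finset.sum_neg_distrib, Finset.sum_neg_distrib, neg_le_neg_iff,
      ← Real.log_prod (fun i hi => (hP i hi _).ne'),
      ← Real.log_prod (fun i hi => (hP i hi _).ne')] at ho
    exact (Real.log_le_log_iff (Finset.prod_pos (fun i hi => hP i hi _))
      (Finset.prod_pos (fun i hi => hP i hi _))).1 ho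
end

section
/- Consider the channel trellis of a binary-input FSISIC: finite state set 𝒮, next-state map η : {0,1} × 𝒮 → 𝒮, edge set E = {0,1} × 𝒮 with s(x,σ) = σ, s'(x,σ) = η(x,σ), input label x(x,σ) = x, and a fixed initial state s₀ ∈ 𝒮. Let P(y, s' | x, s) ≥ 0 satisfy P(y, s' | x, s) = 0 whenever s' ≠ η(x, s), and assume P(y_i, η(x,σ) | x, σ) > 0 for all i ∈ {1,…,N}, x ∈ {0,1}, σ ∈ 𝒮, where y_1,…,y_N are the received symbols. Set branch metrics b_{i,e} = −ln P(y_i, s'(e) | x(e), s(e)). Let 𝒯₀ be the trellis polytope with the additional constraints g_{1,e} = 0 for every edge e with s(e) ≠ s₀, and let P_{𝒯₀}(H) = {g ∈ 𝒯₀ : Q(g) ∈ P(H)}. If g* minimizes Σ_{i,e} b_{i,e} g_{i,e} over P_{𝒯₀}(H) and all entries of g* lie in {0,1}, then f* = Q(g*) ∈ C, and for every codeword c ∈ C, Σ_{(s_1,…,s_N)∈𝒮^N} Π_{i=1}^N P(y_i, s_i | f*_i, s_{i−1}) ≥ Σ_{(s_1,…,s_N)∈𝒮^N} Π_{i=1}^N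 P(y_i, s_i | c_i, s_{i−1}), where s_0 := s₀ in both products; i.e., the LP joint decoder outputs a joint maximum-likelihood codeword. -/
/-- The state sequence `(s₀, s₁, …, s_N)` encoded by `t : Fin N → S` together with the
fixed initial state `s₀`. -/
def stSeq {S : Type*} (N : ℕ) (s₀ : S) (t : Fin N → S) (i : ℕ) : S :=
  if h : 1 ≤ i ∧ i ≤ N then t ⟨i - 1, by omega⟩ else s₀

/-- The deterministic state path driven by the input `c`. -/
def detPath {S : Type*} (η : ℝ → S → S) (s₀ : S) (c : ℕ → ℝ) : ℕ → S
  | 0 => s₀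
  | (i + 1) => η (c (i + 1)) (detPath η s₀ c i)

theorem detPath_pred {S : Type*} (η : ℝ → S → S) (s₀ : S) (c : ℕ → ℝ) (i : ℕ) (hi : 1 ≤ i) :
    detPath η s₀ c i = η (c i) (detPath η s₀ c (i - 1)) := by
  obtain ⟨j, rfl⟩ : ∃ j, i = j + 1 := ⟨i - 1, by omega⟩
  rfl

theorem stSeq_det {S : Type*} (N : ℕ) (s₀ : S) (η : ℝ → S → S) (c : ℕ → ℝ) (i : ℕ) (hi : i ≤ N) :
    stSeq N s₀ (fun j : Fin N => detPath η s₀ c (j + 1)) i = detPath η s₀ c i := by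
  unfold stSeq
  split_ifs with h
  · have : i - 1 + 1 = i := by omega
    simp [this]
  · have : i = 0 := by omega
    subst this; rfl

theorem sumDetPath_collapse {S : Type*} [Fintype S] [DecidableEq S] (N : ℕ)
    (η : ℝ → S → S) (P : ℝ → S → ℝ → S → ℝ) (y : ℕ → ℝ) (s₀ : S)
    (hzero : ∀ yy t xx σ, t ≠ η xx σ → P yy t xx σ = 0) (c : ℕ → ℝ) :
    ∑ t : Fin N → S, ∏ i ∈ Finset.Icc 1 N,
          P (y i) (stSeq N s₀ t i) (c i) (stSeq N s₀ t (i - 1))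
      = ∏ i ∈ Finset.Icc 1 N, P (y i) (η (c i) (detPath η s₀ c (i - 1))) (c i)
          (detPath η s₀ c (i - 1)) := by
  rw [Finset.sum_eq_single (fun j : Fin N => detPath η s₀ c (j + 1))]
  · apply Finset.prod_congr rfl
    intro i hi
    rw [Finset.mem_Icc] at hi
    rw [stSeq_det _ _ _ _ _ hi.2, stSeq_det _ _ _ _ _ (by omega), detPath_pred η s₀ c i hi.1]
  · intro t _ ht
    by_contra hne
    rw [← ne_eq, Finset.prod_ne_zero_iff] at hne
    apply ht
    have key : ∀ i, i ≤ N → stSeq N s₀ t i = detPath η s₀ c i := by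
      intro i
      induction i with
      | zero => intro _; simp [stSeq, detPath]
      | succ k ih =>
        intro hk
        have h1 := hne (k + 1) (Finset.mem_Icc.2 ⟨by omega, hk⟩)
        have h2 : stSeq N s₀ t (k + 1) = η (c (k + 1)) (stSeq N s₀ t (k + 1 - 1)) := by
          by_contra h3
          exact h1 (hzero _ _ _ _ h3)
        rw [h2, Nat.add_sub_cancel, ih (by omega)]; rfl
    funext j
    have := key (j + 1) (by omega)
    rw [← this]
    unfold stSeq
    rw [dif_pos ⟨by omega, by omega⟩]
    congr
  · intro h; exact absurd (Finset.mem_univ _) h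

theorem code_of_relaxed (N : ℕ) (𝓛 : Finset (Finset ℕ)) (h𝓛 : ∀ L ∈ 𝓛, L ⊆ Finset.Icc 1 N)
    (f : ℕ → ℝ) (h01 : ∀ i ∈ Finset.Icc 1 N, f i = 0 ∨ f i = 1) (hf : MemRelaxed N 𝓛 f) :
    MemCode N 𝓛 f := by
  refine ⟨h01, fun L hL => ?_⟩
  set T := L.filter (fun i => f i = 1) with hT
  have hTL : T ⊆ L := Finset.filter_subset _ _
  have h1 : ∑ i ∈ T, f i = T.card := by
    rw [Finset.sum_congr rfl (g := fun _ => (1 : ℝ))]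
    · simp
    · intro i hi; exact (Finset.mem_filter.1 hi).2
  have h2 : ∑ i ∈ L \ T, f i = 0 := by
    apply Finset.sum_eq_zero
    intro i hi
    rw [Finset.mem_sdiff] at hi
    rcases h01 i (h𝓛 L hL hi.1) with h | h
    · exact h
    · exact absurd (Finset.mem_filter.2 ⟨hi.1, h⟩) hi.2
  have h3 : ∑ i ∈ L, f i = T.card := by
    rw [← Finset.sum_sdiff hTL, h1, h2, zero_add]
  rcases Nat.even_or_odd T.card with he | ho
  · obtain ⟨k, hk⟩ := he
    refine ⟨k, ?_⟩
    rw [h3, hk]; push_cast; ring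
  · have := hf.2 L hL T hTL ho
    rw [h1, h2] at this
    linarith

theorem relaxed_of_code (N : ℕ) (𝓛 : Finset (Finset ℕ)) (h𝓛 : ∀ L ∈ 𝓛, L ⊆ Finset.Icc 1 N)
    (f : ℕ → ℝ) (hf : MemCode N 𝓛 f) : MemRelaxed N 𝓛 f := by
  obtain ⟨h01, hpar⟩ := hf
  refine ⟨fun i hi => ?_, fun L hL T hTL hodd => ?_⟩
  · rcases h01 i hi with h | h <;> rw [h] <;> norm_num
  set d : ℕ → ℤ := fun i => if f i = 1 then 1 else 0 with hd
  have hfd : ∀ i ∈ L, f i = (d i : ℝ) := by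
    intro i hi
    rcases h01 i (h𝓛 L hL hi) with h | h <;> simp [hd, h]
  have hd0 : ∀ i, 0 ≤ d i := by intro i; simp only [hd]; split_ifs <;> norm_num
  have hd1 : ∀ i, d i ≤ 1 := by intro i; simp only [hd]; split_ifs <;> norm_num
  have e1 : ∑ i ∈ T, f i = ((∑ i ∈ T, d i : ℤ) : ℝ) := by
    push_cast; exact Finset.sum_congr rfl (fun i hi => hfd i (hTL hi))
  have e2 : ∑ i ∈ L \ T, f i = ((∑ i ∈ L \ T, d i : ℤ) : ℝ) := by
    push_cast; exact Finset.sum_congr rfl (fun i hi => hfd i (Finset.mem_sdiff.1 hi).1)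
  obtain ⟨k, hk⟩ := hpar L hL
  rw [← Finset.sum_sdiff hTL, e1, e2] at hk
  rw [e1, e2]
  have hb1 : 0 ≤ ∑ i ∈ L \ T, d i := Finset.sum_nonneg (fun i _ => hd0 i)
  have hb2 : ∑ i ∈ T, d i ≤ T.card := by
    calc ∑ i ∈ T, d i ≤ ∑ i ∈ T, (1 : ℤ) := Finset.sum_le_sum (fun i _ => hd1 i)
      _ = T.card := by simp
  obtain ⟨m, hm⟩ := hodd
  have hk' : ∑ i ∈ L \ T, d i + ∑ i ∈ T, d i = 2 * k := by exact_mod_cast hk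
  have : ∑ i ∈ T, d i - ∑ i ∈ L \ T, d i ≤ (T.card : ℤ) - 1 := by omega
  exact_mod_cast this

theorem code_congr (N : ℕ) (𝓛 : Finset (Finset ℕ)) (h𝓛 : ∀ L ∈ 𝓛, L ⊆ Finset.Icc 1 N)
    (f f' : ℕ → ℝ) (h : ∀ i ∈ Finset.Icc 1 N, f' i = f i) (hf : MemCode N 𝓛 f) :
    MemCode N 𝓛 f' := by
  refine ⟨fun i hi => by rw [h i hi]; exact hf.1 i hi, fun L hL => ?_⟩
  obtain ⟨k, hk⟩ := hf.2 L hL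
  exact ⟨k, by rw [← hk]; exact Finset.sum_congr rfl (fun i hi => h i (h𝓛 L hL hi))⟩

theorem single_edge {S : Type*} [Fintype S] [DecidableEq S] (σ : S) (g : Fin 2 × S → ℝ)
    (hint : ∀ e, g e = 0 ∨ g e = 1) (h0 : ∀ e, e.2 ≠ σ → g e = 0) (h1 : ∑ e, g e = 1) :
    ∃ x : Fin 2, ∀ e, g e = if e = (x, σ) then 1 else 0 := by
  have h2 : g (0, σ) + g (1, σ) = 1 := by
    rw [← h1, Fintype.sum_prod_type, Fin.sum_univ_two]
    congr 1
    · rw [Finset.sum_eq_single σ (fun s _ hs => h0 _ hs) (by simp)]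
    · rw [Finset.sum_eq_single σ (fun s _ hs => h0 _ hs) (by simp)]
  have : ∃ x : Fin 2, g (x, σ) = 1 ∧ ∀ z, z ≠ x → g (z, σ) = 0 := by
    rcases hint (0, σ) with h | h
    · refine ⟨1, by linarith, ?_⟩
      intro z hz
      fin_cases z
      · exact h
      · exact absurd rfl hz
    · refine ⟨0, h, ?_⟩
      intro z hz
      fin_cases z
      · exact absurd rfl hz
      · show g (1, σ) = 0
        linarith
  obtain ⟨x, hx, hz⟩ := this
  refine ⟨x, ?_⟩
  rintro ⟨z, s⟩
  split_ifs with he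
  · rw [he, hx]
  · by_cases hs : s = σ
    · subst hs
      exact hz z (fun h => he (by rw [h]))
    · exact h0 _ hs

theorem total_flow {S : Type*} [Fintype S] [DecidableEq S] {E : Type*} [Fintype E]
    (N p : ℕ) (hp : p ∈ Finset.Icc 1 N) (s s' : E → S) (g : ℕ → E → ℝ)
    (h : MemTrellis N p s s' g) : ∀ i ∈ Finset.Icc 1 N, ∑ e, g i e = 1 := by
  obtain ⟨-, hc, hn⟩ := h
  have hstep : ∀ i ∈ Finset.Icc 1 (N - 1), ∑ e, g i e = ∑ e, g (i + 1) e := by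
    intro i hi
    rw [← Finset.sum_fiberwise Finset.univ s' (g i), ← Finset.sum_fiberwise Finset.univ s (g (i + 1))]
    exact Finset.sum_congr rfl (fun k _ => hc i hi k)
  have hall : ∀ j, j + 1 ≤ N → ∑ e, g (j + 1) e = ∑ e, g 1 e := by
    intro j
    induction j with
    | zero => intro _; rfl
    | succ k ih =>
      intro hk
      rw [← ih (by omega), ← hstep (k + 1) (Finset.mem_Icc.2 ⟨by omega, by omega⟩)]
  rw [Finset.mem_Icc] at hp
  have h1 : ∑ e, g 1 e = 1 := by
    rw [← hn, ← hall (p - 1) (by omega), Nat.sub_add_cancel hp.1]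
  intro i hi
  rw [Finset.mem_Icc] at hi
  rw [← h1, ← hall (i - 1) (by omega), Nat.sub_add_cancel hi.1]

theorem proj_single {S : Type*} [Fintype S] [DecidableEq S] (σ : S) (x : Fin 2)
    (g : Fin 2 × S → ℝ) (h : ∀ e, g e = if e = (x, σ) then 1 else 0) (w : Fin 2 × S → ℝ) :
    ∑ e, g e * w e = w (x, σ) := by
  simp [h]

theorem path_of_integral {S : Type*} [Fintype S] [DecidableEq S]
    (N p : ℕ) (hp : p ∈ Finset.Icc 1 N) (η : ℝ → S → S) (s₀ : S) (g : ℕ → Fin 2 × S → ℝ)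
    (hT : MemTrellis N p Prod.snd (fun e : Fin 2 × S => η ((e.1 : ℕ) : ℝ) e.2) g)
    (h0 : ∀ e : Fin 2 × S, e.2 ≠ s₀ → g 1 e = 0)
    (hint : ∀ i ∈ Finset.Icc 1 N, ∀ e : Fin 2 × S, g i e = 0 ∨ g i e = 1) :
    ∀ i ∈ Finset.Icc 1 N, ∃ x : Fin 2, ∀ e, g i e = if e = (x, detPath η s₀
      (fun i => ∑ e : Fin 2 × S, g i e * ((e.1 : ℕ) : ℝ)) (i - 1)) then 1 else 0 := by
  have htot := total_flow N p hp _ _ g hT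
  set f : ℕ → ℝ := fun i => ∑ e : Fin 2 × S, g i e * ((e.1 : ℕ) : ℝ) with hf
  have key : ∀ j, j + 1 ≤ N → ∃ x : Fin 2, ∀ e,
      g (j + 1) e = if e = (x, detPath η s₀ f j) then 1 else 0 := by
    intro j
    induction j with
    | zero =>
      intro hj
      have hm : 1 ∈ Finset.Icc 1 N := Finset.mem_Icc.2 ⟨le_rfl, hj⟩
      exact single_edge s₀ (g 1) (hint 1 hm) h0 (htot 1 hm)
    | succ k ih =>
      intro hj
      obtain ⟨x, hx⟩ := ih (by omega)
      have hm : k + 1 + 1 ∈ Finset.Icc 1 N := Finset.mem_Icc.2 ⟨by omega, hj⟩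
      have hfx : f (k + 1) = ((x : ℕ) : ℝ) :=
        proj_single _ x (g (k + 1)) hx (fun e => ((e.1 : ℕ) : ℝ))
      refine single_edge _ (g (k + 1 + 1)) (hint _ hm) ?_ (htot _ hm)
      intro e he
      have hc := hT.2.1 (k + 1) (Finset.mem_Icc.2 ⟨by omega, by omega⟩) e.2
      rw [Finset.sum_eq_zero] at hc
      · have := (Finset.sum_eq_zero_iff_of_nonneg (fun e' _ => (hT.1 _ hm e').1)).1 hc.symm
        exact this e (by simp)
      · intro e' he'
        rw [hx, if_neg]
        rintro rfl
        apply he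
        rw [← (Finset.mem_filter.1 he').2]
        show η ((x : ℕ) : ℝ) _ = η (f (k + 1)) _
        rw [hfx]
  intro i hi
  rw [Finset.mem_Icc] at hi
  have := key (i - 1) (by omega)
  rwa [Nat.sub_add_cancel hi.1] at this

/-- for a binary-input FSISIC (trellis edges `E = {0,1} × 𝒮`, `s(x,σ)=σ`,
`s'(x,σ)=η(x,σ)`, label `x`), an integral optimum `g*` of the joint LP decoder (over the
trellis polytope with initial state `s₀` intersected with `Q⁻¹(P(H))`) projects to a
codeword `f* = Q(g*)` that is a joint maximum-likelihood codeword. -/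
theorem stmt_6 {S : Type*} [Fintype S] [DecidableEq S]
    (N p : ℕ) (hN : 1 ≤ N) (hp : p ∈ Finset.Icc 1 N)
    (η : ℝ → S → S) (P : ℝ → S → ℝ → S → ℝ) (y : ℕ → ℝ) (s₀ : S)
    (hPnn : ∀ yy t xx σ, 0 ≤ P yy t xx σ)
    (hzero : ∀ yy t xx σ, t ≠ η xx σ → P yy t xx σ = 0)
    (hpos : ∀ i ∈ Finset.Icc 1 N, ∀ xx : ℝ, (xx = 0 ∨ xx = 1) → ∀ σ : S,
      0 < P (y i) (η xx σ) xx σ)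
    (𝓛 : Finset (Finset ℕ)) (h𝓛 : ∀ L ∈ 𝓛, L ⊆ Finset.Icc 1 N)
    (b : ℕ → Fin 2 × S → ℝ)
    (hb : ∀ i (e : Fin 2 × S),
      b i e = -Real.log (P (y i) (η ((e.1 : ℕ) : ℝ) e.2) ((e.1 : ℕ) : ℝ) e.2))
    (gstar : ℕ → Fin 2 × S → ℝ)
    (hmem : MemTrellis N p Prod.snd (fun e : Fin 2 × S => η ((e.1 : ℕ) : ℝ) e.2) gstar ∧
      (∀ e : Fin 2 × S, e.2 ≠ s₀ → gstar 1 e = 0) ∧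
      MemRelaxed N 𝓛 (fun i => ∑ e : Fin 2 × S, gstar i e * ((e.1 : ℕ) : ℝ)))
    (hopt : ∀ g : ℕ → Fin 2 × S → ℝ,
      (MemTrellis N p Prod.snd (fun e : Fin 2 × S => η ((e.1 : ℕ) : ℝ) e.2) g ∧
        (∀ e : Fin 2 × S, e.2 ≠ s₀ → g 1 e = 0) ∧
        MemRelaxed N 𝓛 (fun i => ∑ e : Fin 2 × S, g i e * ((e.1 : ℕ) : ℝ))) →
      ∑ i ∈ Finset.Icc 1 N, ∑ e : Fin 2 × S, b i e * gstar i e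
        ≤ ∑ i ∈ Finset.Icc 1 N, ∑ e : Fin 2 × S, b i e * g i e)
    (hint : ∀ i ∈ Finset.Icc 1 N, ∀ e : Fin 2 × S, gstar i e = 0 ∨ gstar i e = 1) :
    MemCode N 𝓛 (fun i => ∑ e : Fin 2 × S, gstar i e * ((e.1 : ℕ) : ℝ)) ∧
    ∀ c : ℕ → ℝ, MemCode N 𝓛 c →
      ∑ t : Fin N → S, ∏ i ∈ Finset.Icc 1 N,
          P (y i) (stSeq N s₀ t i) (c i) (stSeq N s₀ t (i - 1))
        ≤ ∑ t : Fin N → S, ∏ i ∈ Finset.Icc 1 N,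
            P (y i) (stSeq N s₀ t i)
              (∑ e : Fin 2 × S, gstar i e * ((e.1 : ℕ) : ℝ))
              (stSeq N s₀ t (i - 1)) := by
  classical
  obtain ⟨hT, h0, hR⟩ := hmem
  have hpath := path_of_integral N p hp η s₀ gstar hT h0 hint
  set f : ℕ → ℝ := fun i => ∑ e : Fin 2 × S, gstar i e * ((e.1 : ℕ) : ℝ) with hf
  have hfx : ∀ i ∈ Finset.Icc 1 N, ∃ x : Fin 2, f i = ((x : ℕ) : ℝ) ∧
      ∀ e, gstar i e = if e = (x, detPath η s₀ f (i - 1)) then 1 else 0 := by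
    intro i hi
    obtain ⟨x, hx⟩ := hpath i hi
    exact ⟨x, proj_single _ x (gstar i) hx (fun e => ((e.1 : ℕ) : ℝ)), hx⟩
  have hf01 : ∀ i ∈ Finset.Icc 1 N, f i = 0 ∨ f i = 1 := by
    intro i hi
    obtain ⟨x, hx, -⟩ := hfx i hi
    rw [hx]
    fin_cases x <;> simp
  refine ⟨code_of_relaxed N 𝓛 h𝓛 f hf01 hR, ?_⟩
  intro c hc
  have hcost : ∀ (c : ℕ → ℝ) (g : ℕ → Fin 2 × S → ℝ),
      (∀ i ∈ Finset.Icc 1 N, ∃ x : Fin 2, c i = ((x : ℕ) : ℝ) ∧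
        ∀ e, g i e = if e = (x, detPath η s₀ c (i - 1)) then 1 else 0) →
      (∑ i ∈ Finset.Icc 1 N, ∑ e : Fin 2 × S, b i e * g i e =
        - Real.log (∏ i ∈ Finset.Icc 1 N, P (y i) (η (c i) (detPath η s₀ c (i - 1))) (c i)
          (detPath η s₀ c (i - 1)))) ∧
      0 < ∏ i ∈ Finset.Icc 1 N, P (y i) (η (c i) (detPath η s₀ c (i - 1))) (c i)
          (detPath η s₀ c (i - 1)) := by
    intro c g h
    have hpp : ∀ i ∈ Finset.Icc 1 N, 0 < P (y i) (η (c i) (detPath η s₀ c (i - 1))) (c i)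
          (detPath η s₀ c (i - 1)) := by
      intro i hi
      apply hpos i hi
      obtain ⟨x, hx, -⟩ := h i hi
      rw [hx]
      fin_cases x <;> simp
    refine ⟨?_, Finset.prod_pos hpp⟩
    rw [Real.log_prod (fun i hi => (hpp i hi).ne'), ← Finset.sum_neg_distrib]
    apply Finset.sum_congr rfl
    intro i hi
    obtain ⟨x, hx, hg⟩ := h i hi
    have := proj_single _ x (g i) hg (b i)
    rw [Finset.sum_congr rfl (fun e _ => mul_comm (b i e) (g i e)), this, hb, hx]
  -- the path of the codeword `c`
  let bit : ℕ → Fin 2 := fun i => if c i = 1 then 1 else 0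
  let g : ℕ → Fin 2 × S → ℝ := fun i e => if e = (bit i, detPath η s₀ c (i - 1)) then 1 else 0
  have hbit : ∀ i ∈ Finset.Icc 1 N, c i = ((bit i : ℕ) : ℝ) := by
    intro i hi
    rcases hc.1 i hi with h | h <;> simp [bit, h]
  have hgc : ∀ i ∈ Finset.Icc 1 N, ∃ x : Fin 2, c i = ((x : ℕ) : ℝ) ∧
        ∀ e, g i e = if e = (x, detPath η s₀ c (i - 1)) then 1 else 0 :=
    fun i hi => ⟨bit i, hbit i hi, fun e => rfl⟩
  have hQ : ∀ i ∈ Finset.Icc 1 N, ∑ e : Fin 2 × S, g i e * ((e.1 : ℕ) : ℝ) = c i := by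
    intro i hi
    rw [hbit i hi]
    exact proj_single _ (bit i) (g i) (fun e => rfl) (fun e => ((e.1 : ℕ) : ℝ))
  have hle := hopt g ⟨⟨?_, ?_, ?_⟩, ?_, ?_⟩
  · obtain ⟨h1, h2⟩ := hcost f gstar hfx
    obtain ⟨h3, h4⟩ := hcost c g hgc
    rw [h1, h3, neg_le_neg_iff] at hle
    have := (Real.log_le_log_iff h4 h2).1 hle
    rw [sumDetPath_collapse N η P y s₀ hzero c]
    exact this.trans (sumDetPath_collapse N η P y s₀ hzero f).ge
  · intro i _ e
    simp only [g]
    split_ifs <;> norm_num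
  · intro i hi k
    rw [Finset.mem_Icc] at hi
    have hi' : i ∈ Finset.Icc 1 N := Finset.mem_Icc.2 ⟨hi.1, by omega⟩
    simp only [g, Finset.sum_ite_eq', Finset.mem_filter, Finset.mem_univ, true_and,
      Nat.add_sub_cancel]
    rw [detPath_pred η s₀ c i hi.1, hbit i hi']
  · simp [g]
  · intro e he
    simp only [g]
    rw [if_neg]
    rintro rfl
    exact he rfl
  · exact relaxed_of_code N 𝓛 h𝓛 _ (code_congr N 𝓛 h𝓛 c _ hQ hc)
end

section
/- Let N ≥ 1, E a finite edge set with output label a : E → ℝ, σ > 0, and let g = (g_{i,e}) with g_{i,e} ∈ [0,1] and Σ_{e∈E} g_{i,e} = 1 for every i ∈ {1,…,N}. Define p_i = Σ_{e∈E} g_{i,e} a(e), let c ∈ ℝ^N with c ≠ p, set ‖d‖² = Σ_{i=1}^N (c_i − p_i)² and σ_p² = Σ_{i=1}^N Σ_{e∈E} g_{i,e} a(e)² − Σ_{i=1}^N p_i². Let μ be the product measure on ℝ^N whose i-th factor is the Gaussian measure with mean c_i and variance σ². Then μ({ y ∈ ℝ^N : Σ_{i=1}^N Σ_{e∈E} g_{i,e}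 (y_i − a(e))² ≤ Σ_{i=1}^N (y_i − c_i)² }) = Q( (‖d‖² + σ_p²) / (2σ‖d‖) ), i.e., the pairwise error probability between the signal-space codeword c and the signal-space pseudo-codeword p equals Q(d_gen(c,p)/(2σ)), where d_gen(c,p) = (‖d‖² + σ_p²)/‖d‖ is the generalized Euclidean distance. -/
open MeasureTheory ProbabilityTheory

/-- The Gaussian tail function `Q(x) = (1/√(2π)) ∫_x^∞ e^{−u²/2} du`. -/
noncomputable def gaussQ (x : ℝ) : ℝ :=
  (Real.sqrt (2 * Real.pi))⁻¹ * ∫ u in Set.Ioi x, Real.exp (-u ^ 2 / 2)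

/-- A normalized linear combination of independent Gaussians is standard Gaussian. -/
theorem map_lin_gaussian (N : ℕ) (c w : Fin N → ℝ) (v : NNReal)
    (hw : (v : ℝ) * ∑ i, w i ^ 2 = 1) :
    (Measure.pi fun i => gaussianReal (c i) v).map (fun y => ∑ i, w i * (y i - c i))
      = gaussianReal 0 1 := by
  refine Measure.ext_of_charFun ?_
  have hind : iIndepFun (fun i (y : Fin N → ℝ) => w i * (y i - c i))
      (Measure.pi fun i => gaussianReal (c i) v) :=
    iIndepFun_pi (X := fun i x => w i * (x - c i)) (fun i => by fun_prop)
  rw [hind.charFun_map_fun_sum_eq_prod (fun i => Measurable.aemeasurable (by fun_prop))]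
  ext t
  rw [Finset.prod_apply]
  have hlaw : ∀ i, (Measure.pi fun i => gaussianReal (c i) v).map
      (fun y : Fin N → ℝ => w i * (y i - c i))
      = gaussianReal 0 (.mk (w i ^ 2) (sq_nonneg _) * v) := by
    intro i
    have h0 : HasLaw (fun y : Fin N → ℝ => y i) (gaussianReal (c i) v)
        (Measure.pi fun i => gaussianReal (c i) v) :=
      ⟨(measurable_pi_apply i).aemeasurable, (measurePreserving_eval (fun i => gaussianReal (c i) v) i).map_eq⟩
    have h1 := (gaussianReal_const_mul (gaussianReal_sub_const h0 (c i)) (w i)).map_eq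
    simpa using h1
  simp_rw [hlaw, charFun_gaussianReal, ← Complex.exp_sum]
  congr 1
  have hw' : (v : ℂ) * ∑ i, (w i : ℂ) ^ 2 = 1 := by exact_mod_cast congrArg Complex.ofReal hw
  have : ∀ i, ((t : ℂ) * ((0 : ℝ) : ℂ) * Complex.I
      - (((NNReal.mk (w i ^ 2) (sq_nonneg _) * v : NNReal) : ℝ) : ℂ) * (t : ℂ) ^ 2 / 2)
      = (w i : ℂ) ^ 2 * (-(v : ℂ) * (t : ℂ) ^ 2 / 2) := by
    intro i
    push_cast
    simp
    ring
  rw [Finset.sum_congr rfl (fun i _ => this i), ← Finset.sum_mul]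
  push_cast
  linear_combination (-(t : ℂ) ^ 2 / 2) * hw'

theorem gaussian_Ici (x : ℝ) : gaussianReal 0 1 (Set.Ici x) = ENNReal.ofReal (gaussQ x) := by
  rw [gaussianReal_apply_eq_integral _ one_ne_zero, integral_Ici_eq_integral_Ioi, gaussQ,
    ← integral_const_mul]
  simp [gaussianPDFReal]

theorem stmt_9 {E : Type*} [Fintype E]
    (N : ℕ) (hN : 1 ≤ N) (a : E → ℝ) (σ : ℝ) (hσ : 0 < σ)
    (g : Fin N → E → ℝ)
    (hbox : ∀ i e, 0 ≤ g i e ∧ g i e ≤ 1)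
    (hnorm : ∀ i, ∑ e : E, g i e = 1)
    (c p : Fin N → ℝ) (hpdef : ∀ i, p i = ∑ e : E, g i e * a e) (hcp : c ≠ p)
    (dsq σpsq : ℝ)
    (hdsq : dsq = ∑ i, (c i - p i) ^ 2)
    (hσpsq : σpsq = ∑ i, ∑ e : E, g i e * a e ^ 2 - ∑ i, p i ^ 2)
    (μ : Measure (Fin N → ℝ))
    (hμ : μ = Measure.pi fun i => gaussianReal (c i) (Real.toNNReal (σ ^ 2))) :
    μ {y | ∑ i, ∑ e : E, g i e * (y i - a e) ^ 2 ≤ ∑ i, (y i - c i) ^ 2}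
      = ENNReal.ofReal (gaussQ ((dsq + σpsq) / (2 * σ * Real.sqrt dsq))) := by
  have hD : 0 < dsq := by
    obtain ⟨i, hi⟩ := Function.ne_iff.mp hcp
    rw [hdsq]
    exact Finset.sum_pos' (fun i _ => sq_nonneg _)
      ⟨i, Finset.mem_univ _, by have := sub_ne_zero.mpr hi; positivity⟩
  have hs : 0 < Real.sqrt dsq := Real.sqrt_pos.mpr hD
  have hs2 : Real.sqrt dsq ^ 2 = dsq := Real.sq_sqrt hD.le
  rw [← gaussian_Ici, ← map_lin_gaussian N c (fun i => (p i - c i) / (σ * Real.sqrt dsq))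
    (Real.toNNReal (σ ^ 2)) ?_, ← hμ, Measure.map_apply (by fun_prop) measurableSet_Ici]
  · congr 1
    ext y
    simp only [Set.mem_setOf_eq, Set.mem_preimage, Set.mem_Ici]
    have e1 : ∑ i, (p i - c i) / (σ * Real.sqrt dsq) * (y i - c i)
        = (2 * ∑ i, (p i - c i) * (y i - c i)) / (2 * σ * Real.sqrt dsq) := by
      rw [Finset.mul_sum, Finset.sum_div]
      refine Finset.sum_congr rfl fun i _ => ?_
      field_simp
    rw [e1, div_le_div_iff_of_pos_right (by positivity)]
    have e2 : ∀ i, ∑ e : E, g i e * (y i - a e) ^ 2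
        = y i ^ 2 - 2 * y i * p i + ∑ e : E, g i e * a e ^ 2 := by
      intro i
      have : ∀ e, g i e * (y i - a e) ^ 2
          = y i ^ 2 * g i e - 2 * y i * (g i e * a e) + g i e * a e ^ 2 := fun e => by ring
      simp_rw [this, Finset.sum_add_distrib, Finset.sum_sub_distrib, ← Finset.mul_sum]
      rw [hnorm, ← hpdef, mul_one]
    have e3 : ∑ i, ∑ e : E, g i e * (y i - a e) ^ 2 - ∑ i, (y i - c i) ^ 2
        = dsq + σpsq - 2 * ∑ i, (p i - c i) * (y i - c i) := by
      rw [hdsq, hσpsq, Finset.mul_sum, ← Finset.sum_sub_distrib, ← Finset.sum_sub_distrib,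
        ← Finset.sum_add_distrib, ← Finset.sum_sub_distrib]
      refine Finset.sum_congr rfl fun i _ => ?_
      rw [e2]
      ring
    constructor <;> intro h <;> linarith
  · rw [Real.coe_toNNReal _ (sq_nonneg σ)]
    have : ∀ i, ((p i - c i) / (σ * Real.sqrt dsq)) ^ 2 = (c i - p i) ^ 2 / (σ ^ 2 * dsq) := by
      intro i
      rw [div_pow, mul_pow, hs2]
      ring
    simp_rw [this]
    rw [← Finset.sum_div, ← hdsq]
    field_simp
end

section
/- Let m ≥ 1 and for each i ∈ {1,…,m} let X_i be a closed convex subset of ℝ^{n_i}; set X = X_1 × ⋯ × X_m ⊆ ℝ^{n_1} × ⋯ × ℝ^{n_m}. Suppose f : ℝ^{n_1} × ⋯ × ℝ^{n_m} → ℝ is continuously differentiable and convex on X, and that for every x ∈ X and every i, the function ξ ↦ f(x_1,…,x_{i−1}, ξ, x_{i+1},…,x_m) attains a unique minimum over X_i. Given x^0 ∈ X, define the sequence (x^k) by x_i^{k+1} = argmin_{ξ∈X_i} f(x_1^{k+1},…,x_{i−1}^{k+1}, ξ, x_{i+1}^k,…,x_m^k) for i = 1,…,m. Then every limit point of the sequence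 (x^k) minimizes f over X. -/
open Filter Topology Set

lemma aux_deriv_le {g : ℝ → ℝ} {d c : ℝ} (hg : HasDerivAt g d 0)
    (h : ∀ t, 0 < t → t ≤ 1 → g t ≤ g 0 + t * c) : d ≤ c := by
  have h1 := hg.tendsto_slope_zero_right
  refine le_of_tendsto h1 ?_
  have h2 : Ioc (0:ℝ) 1 ∈ 𝓝[>] (0:ℝ) := Ioc_mem_nhdsGT one_pos
  filter_upwards [h2] with t ht
  have := h t ht.1 ht.2
  rw [zero_add, smul_eq_mul, inv_mul_le_iff₀ ht.1]
  linarith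

lemma aux_global {m : ℕ} {n : Fin m → ℕ}
    (X : ∀ i : Fin m, Set (Fin (n i) → ℝ)) (hXconv : ∀ i, Convex ℝ (X i))
    (f : (∀ i : Fin m, Fin (n i) → ℝ) → ℝ) (hf1 : ContDiff ℝ 1 f)
    (hfconv : ConvexOn ℝ {x | ∀ i, x i ∈ X i} f)
    (z : ∀ i : Fin m, Fin (n i) → ℝ) (hz : ∀ i, z i ∈ X i)
    (hmin : ∀ i, ∀ ξ ∈ X i, f z ≤ f (Function.update z i ξ))
    (w : ∀ i : Fin m, Fin (n i) → ℝ) (hw : ∀ i, w i ∈ X i) : f z ≤ f w := by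
  have hd : HasFDerivAt f (fderiv ℝ f z) z :=
    (hf1.differentiable (by norm_num)).differentiableAt.hasFDerivAt
  set D := fderiv ℝ f z
  have hline : ∀ v, HasDerivAt (fun t : ℝ => f (z + t • v)) (D v) 0 := by
    intro v
    have h1 : HasDerivAt (fun t : ℝ => z + t • v) v 0 := by
      simpa using ((hasDerivAt_id (0:ℝ)).smul_const v).const_add z
    have h2 : HasFDerivAt f D (z + (0:ℝ) • v) := by simpa using hd
    exact h2.comp_hasDerivAt (0:ℝ) h1
  have hblock : ∀ i, 0 ≤ D (Pi.single i (w i - z i)) := by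
    intro i
    have h1 := (hline (Pi.single i (w i - z i))).neg
    have h2 := aux_deriv_le (c := 0) h1 (by
      intro t ht0 ht1
      have e : z + t • (Pi.single i (w i - z i) : ∀ i : Fin m, Fin (n i) → ℝ)
          = Function.update z i (z i + t • (w i - z i)) := by
        funext j
        by_cases hj : j = i
        · subst hj; simp
        · simp [hj]
      have := hmin i (z i + t • (w i - z i))
        ((hXconv i).add_smul_sub_mem (hz i) (hw i) ⟨ht0.le, ht1⟩)
      simp only [Pi.neg_apply, e, zero_smul, add_zero, mul_zero]
      linarith)
    linarith
  have hsum : 0 ≤ D (w - z) := by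
    rw [← Finset.univ_sum_single (w - z), map_sum]
    exact Finset.sum_nonneg fun i _ => hblock i
  have h3 := aux_deriv_le (c := f w - f z) (hline (w - z)) (by
    intro t ht0 ht1
    have h4 := hfconv.2 (show z ∈ {x : ∀ i : Fin m, Fin (n i) → ℝ | ∀ i, x i ∈ X i} from hz)
      (show w ∈ {x : ∀ i : Fin m, Fin (n i) → ℝ | ∀ i, x i ∈ X i} from hw)
      (show 0 ≤ 1 - t by linarith) ht0.le (by ring)
    have e : z + t • (w - z) = (1 - t) • z + t • w := by module
    simp only [e, zero_smul, add_zero]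
    simp only [smul_eq_mul] at h4
    linarith)
  linarith

lemma aux_step {m : ℕ} {n : Fin m → ℕ}
    (X : ∀ i : Fin m, Set (Fin (n i) → ℝ)) (hXcl : ∀ i, IsClosed (X i))
    (f : (∀ i : Fin m, Fin (n i) → ℝ) → ℝ) (hf : Continuous f)
    (hfconv : ConvexOn ℝ {x | ∀ i, x i ∈ X i} f)
    (huniq : ∀ x, (∀ i, x i ∈ X i) → ∀ i : Fin m,
      ∃! ξ, ξ ∈ X i ∧ ∀ ξ' ∈ X i, f (Function.update x i ξ) ≤ f (Function.update x i ξ'))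
    (U : Ultrafilter ℕ) (z : ∀ i : Fin m, Fin (n i) → ℝ) (hz : ∀ i, z i ∈ X i)
    (u : ℕ → ∀ i : Fin m, Fin (n i) → ℝ) (hu : ∀ k i, u k i ∈ X i)
    (hlim : Tendsto u U (𝓝 z)) (i : Fin m) (ξ : ℕ → Fin (n i) → ℝ)
    (hξ : ∀ k, ξ k ∈ X i)
    (hmin : ∀ k, ∀ η ∈ X i, f (Function.update (u k) i (ξ k)) ≤ f (Function.update (u k) i η))
    (hval : ∀ k, f z ≤ f (Function.update (u k) i (ξ k))) :
    (∀ η ∈ X i, f z ≤ f (Function.update z i η)) ∧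
      Tendsto (fun k => Function.update (u k) i (ξ k)) U (𝓝 z) := by
  have hui : Tendsto (fun k => u k i) U (𝓝 (z i)) := (tendsto_pi_nhds.1 hlim) i
  have hblock : ∀ η ∈ X i, f z ≤ f (Function.update z i η) := by
    intro η hη
    have h1 : Tendsto (fun k => f (Function.update (u k) i η)) U
        (𝓝 (f (Function.update z i η))) :=
      (hf.tendsto _).comp (hlim.update i tendsto_const_nhds)
    exact ge_of_tendsto' h1 fun k => (hval k).trans (hmin k η hη)
  refine ⟨hblock, ?_⟩
  suffices h : Tendsto ξ U (𝓝 (z i)) by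
    simpa using hlim.update i h
  by_contra hcon
  rw [Metric.tendsto_nhds] at hcon
  push Not at hcon
  obtain ⟨γ, hγ, hfar⟩ := hcon
  have hfar' : ∀ᶠ k in U, γ ≤ dist (ξ k) (z i) := hfar
  have hnear : ∀ᶠ k in U, dist (u k i) (z i) < γ := Metric.tendsto_nhds.1 hui γ hγ
  have hcross : ∀ k, ∃ p, (γ ≤ dist (ξ k) (z i) ∧ dist (u k i) (z i) < γ) →
      p ∈ segment ℝ (u k i) (ξ k) ∧ dist p (z i) = γ := by
    intro k
    by_cases hk : γ ≤ dist (ξ k) (z i) ∧ dist (u k i) (z i) < γ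
    · obtain ⟨p, hp, hp'⟩ := (convex_segment (𝕜 := ℝ) (u k i) (ξ k)).isPreconnected.intermediate_value
        (left_mem_segment ℝ _ _) (right_mem_segment ℝ _ _) (f := fun p => dist p (z i))
        (by fun_prop) ⟨hk.2.le, hk.1⟩
      exact ⟨p, fun _ => ⟨hp, hp'⟩⟩
    · exact ⟨0, fun h => absurd h hk⟩
  choose p hp using hcross
  have hp1 : ∀ᶠ k in U, p k ∈ X i ∧ dist (p k) (z i) = γ ∧
      f (Function.update (u k) i (p k)) ≤ f (u k) := by
    filter_upwards [hfar', hnear] with k h1 h2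
    obtain ⟨⟨a, b, ha, hb, hab, hseg⟩, h4⟩ := hp k ⟨h1, h2⟩
    have hmem : ∀ j, Function.update (u k) i (ξ k) j ∈ X j := by
      intro j
      by_cases hj : j = i
      · subst hj; simpa using hξ k
      · simpa [hj] using hu k j
    have e : Function.update (u k) i (p k) = a • u k + b • Function.update (u k) i (ξ k) := by
      funext j
      by_cases hj : j = i
      · subst hj; simp [hseg]
      · simp [hj, ← add_smul, hab]
    have hX := hfconv.1 (show u k ∈ {x : ∀ i : Fin m, Fin (n i) → ℝ | ∀ i, x i ∈ X i} from hu k) hmem ha hb hab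
    have hle := hfconv.2 (show u k ∈ {x : ∀ i : Fin m, Fin (n i) → ℝ | ∀ i, x i ∈ X i} from hu k) hmem ha hb hab
    rw [← e] at hX hle
    refine ⟨by simpa using hX i, h4, hle.trans ?_⟩
    have h5 := hmin k (u k i) (hu k i)
    rw [Function.update_eq_self] at h5
    simp only [smul_eq_mul]
    calc _ ≤ a * f (u k) + b * f (u k) := by gcongr
      _ = f (u k) := by rw [← add_mul, hab, one_mul]
  obtain ⟨q, hq, hpq⟩ := (isCompact_sphere (z i) γ).ultrafilter_le_nhds (U.map p) (by
    rw [le_principal_iff]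
    exact hp1.mono fun k h => h.2.1)
  have hpq' : Tendsto p U (𝓝 q) := hpq
  have hqX : q ∈ X i := (hXcl i).mem_of_tendsto hpq' (hp1.mono fun k h => h.1)
  have hfq : f (Function.update z i q) ≤ f z :=
    le_of_tendsto_of_tendsto ((hf.tendsto _).comp (hlim.update i hpq'))
      ((hf.tendsto _).comp hlim) (hp1.mono fun k h => h.2.2)
  have hqz : q = z i := (huniq z hz i).unique ⟨hqX, fun η hη => hfq.trans (hblock η hη)⟩
    ⟨hz i, fun η hη => by rw [Function.update_eq_self]; exact hblock η hη⟩
  rw [Metric.mem_sphere, hqz, dist_self] at hq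
  exact hγ.ne hq


/-- block coordinate descent / Gauss–Seidel convergence: if
`f` is continuously differentiable, convex on `X = X₁ × ⋯ × X_m` with each `X_i`
closed and convex, and each block-minimization has a unique minimizer, then every
limit point of the cyclic block-coordinate-descent sequence minimizes `f` over `X`. -/
theorem stmt_15 (m : ℕ) (hm : 1 ≤ m) (n : Fin m → ℕ)
    (X : ∀ i : Fin m, Set (Fin (n i) → ℝ))
    (hXcl : ∀ i, IsClosed (X i)) (hXconv : ∀ i, Convex ℝ (X i))
    (f : (∀ i : Fin m, Fin (n i) → ℝ) → ℝ)
    (hf1 : ContDiff ℝ 1 f)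
    (hfconv : ConvexOn ℝ {x | ∀ i, x i ∈ X i} f)
    (huniq : ∀ x, (∀ i, x i ∈ X i) → ∀ i : Fin m,
      ∃! ξ, ξ ∈ X i ∧ ∀ ξ' ∈ X i, f (Function.update x i ξ) ≤ f (Function.update x i ξ'))
    (x : ℕ → ∀ i : Fin m, Fin (n i) → ℝ)
    (hx0 : ∀ i, x 0 i ∈ X i)
    (hupd : ∀ k (i : Fin m),
      x (k + 1) i ∈ X i ∧
      ∀ ξ ∈ X i,
        f (fun j => if j.val < i.val then x (k + 1) j
            else if h : j = i then h ▸ x (k + 1) i else x k j)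
          ≤ f (fun j => if j.val < i.val then x (k + 1) j
            else if h : j = i then h ▸ ξ else x k j)) :
    ∀ z, MapClusterPt z Filter.atTop x →
      (∀ i, z i ∈ X i) ∧ ∀ w, (∀ i, w i ∈ X i) → f z ≤ f w := by

  intro z hzc
  obtain ⟨U, hU, hxz⟩ := mapClusterPt_iff_ultrafilter.1 hzc
  have hf : Continuous f := hf1.continuous
  have hxX : ∀ k i, x k i ∈ X i := by
    intro k i
    cases k with
    | zero => exact hx0 i
    | succ k => exact (hupd k i).1
  have hz : ∀ i, z i ∈ X i := fun i =>
    (hXcl i).mem_of_tendsto ((tendsto_pi_nhds.1 hxz) i) (Eventually.of_forall fun k => hxX k i)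
  let y : ℕ → ℕ → ∀ i : Fin m, Fin (n i) → ℝ := fun l k j =>
    if j.val < l then x (k + 1) j else x k j
  have hy0 : ∀ k, y 0 k = x k := fun k => by funext j; simp [y]
  have hym : ∀ k, y m k = x (k + 1) := fun k => by funext j; simp [y]
  have hyX : ∀ l k i, y l k i ∈ X i := by
    intro l k i
    simp only [y]
    split_ifs
    · exact hxX _ _
    · exact hxX _ _
  have hform : ∀ k (i : Fin m) (ξ : Fin (n i) → ℝ),
      (fun j : Fin m => if j.val < i.val then x (k + 1) j
            else if h : j = i then h ▸ ξ else x k j) = Function.update (y i.val k) i ξ := by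
    intro k i ξ
    funext j
    by_cases hj : j = i
    · subst hj; simp
    · simp [hj, y]
  have hystep : ∀ k (i : Fin m), y (i.val + 1) k = Function.update (y i.val k) i (x (k + 1) i) := by
    intro k i
    funext j
    by_cases hj : j = i
    · subst hj; simp [y]
    · have : j.val ≠ i.val := fun h => hj (Fin.ext h)
      have h2 : j.val < i.val + 1 ↔ j.val < i.val := by omega
      simp [hj, y, h2]
  have hmin : ∀ k (i : Fin m), ∀ η ∈ X i,
      f (Function.update (y i.val k) i (x (k + 1) i)) ≤ f (Function.update (y i.val k) i η) := by
    intro k i η hη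
    have := (hupd k i).2 η hη
    rwa [hform, hform] at this
  have hdec1 : ∀ k l, l < m → f (y (l + 1) k) ≤ f (y l k) := by
    intro k l hl
    have h1 := hmin k ⟨l, hl⟩ (y l k ⟨l, hl⟩) (hyX _ _ _)
    rw [← hystep, Function.update_eq_self] at h1
    exact h1
  have hdec : ∀ k d l, l + d ≤ m → f (y (l + d) k) ≤ f (y l k) := by
    intro k d
    induction d with
    | zero => intro l _; exact le_rfl
    | succ d ih =>
      intro l hl
      exact (hdec1 k (l + d) (by omega)).trans (ih l (by omega))
  have hanti : Antitone fun k => f (x k) := antitone_nat_of_succ_le fun k => by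
    have := hdec k m 0 (by omega)
    rwa [zero_add, hym, hy0] at this
  have hlow : ∀ k, f z ≤ f (x k) := by
    intro k
    refine le_of_tendsto ((hf.tendsto _).comp hxz) ?_
    exact hU (by filter_upwards [eventually_ge_atTop k] with k' hk' using hanti hk')
  have hylow : ∀ k l, l ≤ m → f z ≤ f (y l k) := by
    intro k l hl
    have := hdec k (m - l) l (by omega)
    rw [Nat.add_sub_cancel' hl, hym] at this
    exact (hlow _).trans this
  have hstep : ∀ i : Fin m, Tendsto (y i.val) U (𝓝 z) →
      (∀ η ∈ X i, f z ≤ f (Function.update z i η)) ∧ Tendsto (y (i.val + 1)) U (𝓝 z) := by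
    intro i hi
    have h := aux_step X hXcl f hf hfconv huniq U z hz (y i.val) (hyX _) hi i
      (fun k => x (k + 1) i) (fun k => hxX _ _) (fun k => hmin k i)
      (fun k => by rw [← hystep]; exact hylow k _ i.isLt)
    refine ⟨h.1, ?_⟩
    have e : y (i.val + 1) = fun k => Function.update (y i.val k) i (x (k + 1) i) :=
      funext fun k => hystep k i
    rw [e]
    exact h.2
  have hall : ∀ l, l ≤ m → Tendsto (y l) U (𝓝 z) := by
    intro l
    induction l with
    | zero =>
      intro _
      have e : y 0 = x := funext hy0
      rw [e]; exact hxz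
    | succ l ih => intro hl; exact (hstep ⟨l, hl⟩ (ih (by omega))).2
  exact ⟨hz, fun w hw => aux_global X hXconv f hf1 hfconv z hz
    (fun i => (hstep i (hall i.val i.isLt.le)).1) w hw⟩
end

section
/- Let J be a finite index set, for each j ∈ J let E_j be a nonempty finite set, let T be a finite set of cardinality O ≥ 1, and let K₁, K₂ > 0. Consider vectors v lying in a Euclidean space that contains distinguished coordinate blocks w_j(v) = (w_{j,B}(v))_{B∈E_j} for each j ∈ J and g(v) = (g_e(v))_{e∈T}, together with a linear cost functional F. Let A be a nonempty set of such vectors with the property that every v ∈ A satisfies w_{j,B}(v) ≥ 0 and Σ_{B∈E_j} w_{j,B}(v) = 1 for each j ∈ J, and g_e(v) ≥ 0 and Σ_{e∈T} g_e(v) = 1. Define the entropy H(q) = −Σ_i q_i ln q_i (with 0·ln 0 = 0). Suppose v* minimizes F over A and ṽ minimizes v ↦ F(v) − (1/K₁) Σ_{j∈J} H(w_j(v)) − (1/K₂) H(g(v)) over A. Then 0 ≤ F(ṽ) − F(v*) ≤ (1/K₁) Σ_{j∈J} ln|E_j| + (1/K₂) ln O. -/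
theorem entropy_nonneg_aux {ι : Type*} [Fintype ι] (q : ι → ℝ) (h0 : ∀ i, 0 ≤ q i)
    (h1 : ∑ i, q i = 1) : 0 ≤ -∑ i, q i * Real.log (q i) := by
  rw [← Finset.sum_neg_distrib]
  refine Finset.sum_nonneg fun i _ => ?_
  have hi : q i ≤ 1 := by
    rw [← h1]
    exact Finset.single_le_sum (fun j _ => h0 j) (Finset.mem_univ i)
  have := mul_nonpos_of_nonneg_of_nonpos (h0 i) (Real.log_nonpos (h0 i) hi)
  linarith

theorem entropy_le_aux {ι : Type*} [Fintype ι] (hc : 0 < Fintype.card ι) (q : ι → ℝ)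
    (h0 : ∀ i, 0 ≤ q i) (h1 : ∑ i, q i = 1) :
    -∑ i, q i * Real.log (q i) ≤ Real.log (Fintype.card ι) := by
  have hn : (0 : ℝ) < Fintype.card ι := by exact_mod_cast hc
  have key : ∀ i, -(q i * Real.log (q i)) ≤
      q i * Real.log (Fintype.card ι) + ((Fintype.card ι : ℝ)⁻¹ - q i) := by
    intro i
    rcases (h0 i).eq_or_lt with h | h
    · rw [← h]
      simp
    · have h2 := Real.negMulLog_le_one_sub_self (mul_nonneg hn.le (h0 i))
      rw [Real.negMulLog, Real.log_mul hn.ne' h.ne'] at h2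
      refine le_of_mul_le_mul_left ?_ hn
      have h3 : (Fintype.card ι : ℝ) * (Fintype.card ι : ℝ)⁻¹ = 1 := mul_inv_cancel₀ hn.ne'
      linear_combination h2 - h3
  have hs := Finset.sum_le_sum fun i (_ : i ∈ Finset.univ) => key i
  rw [Finset.sum_neg_distrib, Finset.sum_add_distrib, Finset.sum_sub_distrib,
    ← Finset.sum_mul, h1] at hs
  simp only [Finset.sum_const, Finset.card_univ, nsmul_eq_mul, mul_inv_cancel₀ hn.ne'] at hs
  linarith

/-- relaxation bound between Problem-P and its entropy-regularized
version Problem-PS: `0 ≤ F(ṽ) − F(v*) ≤ (1/K₁) Σ_j ln|E_j| + (1/K₂) ln O`. -/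
theorem stmt_16 {V : Type*} [AddCommGroup V] [Module ℝ V]
    {J : Type*} [Fintype J] (E : J → Type*) [∀ j, Fintype (E j)] [∀ j, Nonempty (E j)]
    {T : Type*} [Fintype T] (O : ℕ) (hO : Fintype.card T = O) (hO1 : 1 ≤ O)
    (K₁ K₂ : ℝ) (hK₁ : 0 < K₁) (hK₂ : 0 < K₂)
    (F : V →ₗ[ℝ] ℝ) (w : ∀ j : J, V →ₗ[ℝ] (E j → ℝ)) (g : V →ₗ[ℝ] (T → ℝ))
    (A : Set V) (hA : A.Nonempty)
    (hsimp : ∀ v ∈ A,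
      (∀ j : J, (∀ B : E j, 0 ≤ w j v B) ∧ ∑ B : E j, w j v B = 1) ∧
      ((∀ e : T, 0 ≤ g v e) ∧ ∑ e : T, g v e = 1))
    (vstar : V) (hv1 : vstar ∈ A) (hv2 : ∀ v ∈ A, F vstar ≤ F v)
    (vt : V) (hv3 : vt ∈ A)
    (hv4 : ∀ v ∈ A,
      F vt - (1 / K₁) * ∑ j : J, (-∑ B : E j, w j vt B * Real.log (w j vt B))
          - (1 / K₂) * (-∑ e : T, g vt e * Real.log (g vt e))
        ≤ F v - (1 / K₁) * ∑ j : J, (-∑ B : E j, w j v B * Real.log (w j v B))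
          - (1 / K₂) * (-∑ e : T, g v e * Real.log (g v e))) :
    0 ≤ F vt - F vstar ∧
      F vt - F vstar
        ≤ (1 / K₁) * ∑ j : J, Real.log (Fintype.card (E j))
          + (1 / K₂) * Real.log O := by
  refine ⟨sub_nonneg.2 (hv2 vt hv3), ?_⟩
  have h := hv4 vstar hv1
  obtain ⟨hs1, hs2, hs3⟩ := hsimp vstar hv1
  obtain ⟨ht1, ht2, ht3⟩ := hsimp vt hv3
  have a1 : 0 ≤ (1 / K₁) * ∑ j : J, (-∑ B : E j, w j vstar B * Real.log (w j vstar B)) :=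
    mul_nonneg (by positivity)
      (Finset.sum_nonneg fun j _ => entropy_nonneg_aux _ (hs1 j).1 (hs1 j).2)
  have a2 : 0 ≤ (1 / K₂) * (-∑ e : T, g vstar e * Real.log (g vstar e)) :=
    mul_nonneg (by positivity) (entropy_nonneg_aux _ hs2 hs3)
  have a3 : (1 / K₁) * ∑ j : J, (-∑ B : E j, w j vt B * Real.log (w j vt B)) ≤
      (1 / K₁) * ∑ j : J, Real.log (Fintype.card (E j)) :=
    mul_le_mul_of_nonneg_left
      (Finset.sum_le_sum fun j _ => entropy_le_aux Fintype.card_pos _ (ht1 j).1 (ht1 j).2)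
      (by positivity)
  have a4 : (1 / K₂) * (-∑ e : T, g vt e * Real.log (g vt e)) ≤ (1 / K₂) * Real.log O := by
    subst hO
    exact mul_le_mul_of_nonneg_left (entropy_le_aux hO1 _ ht2 ht3) (by positivity)
  linarith
end

section
/- Let I be a finite index set, L ⊆ I with |L| ≥ 3, and 0 ≤ ε ≤ 1/6. Let λ, μ : I → ℝ with 0 ≤ λ_i ≤ 1 and |μ_i − λ_i| ≤ ε for all i ∈ I, and suppose μ satisfies Σ_{i∈S} μ_i − Σ_{i∈L∖S} μ_i ≤ |S| − 1 for every subset S ⊆ L of odd cardinality. Define λ̂_i = (1 − 6ε)·λ_i + 3ε. Then 0 ≤ λ̂_i ≤ 1 for all i, and Σ_{i∈S} λ̂_i − Σ_{i∈L∖S} λ̂_i ≤ |S| − 1 for every subset S ⊆ L of odd cardinality. -/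
/-- if per-check estimates `μ` within `ε` of `λ ∈ [0,1]^I` satisfy the
local codeword polytope constraints of a check `L` with `|L| ≥ 3` and `ε ≤ 1/6`, then
`λ̂ = (1−6ε)λ + 3ε·1` lies in `[0,1]^I` and satisfies them as well. -/
theorem stmt_17 {I : Type*} [Fintype I] [DecidableEq I]
    (L : Finset I) (hL : 3 ≤ L.card) (ε : ℝ) (hε0 : 0 ≤ ε) (hε : ε ≤ 1 / 6)
    (lam mu : I → ℝ) (hlam : ∀ i, 0 ≤ lam i ∧ lam i ≤ 1)
    (hmu : ∀ i, |mu i - lam i| ≤ ε)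
    (hloc : ∀ S ⊆ L, Odd S.card →
      ∑ i ∈ S, mu i - ∑ i ∈ L \ S, mu i ≤ (S.card : ℝ) - 1) :
    (∀ i, 0 ≤ (1 - 6 * ε) * lam i + 3 * ε ∧ (1 - 6 * ε) * lam i + 3 * ε ≤ 1) ∧
    (∀ S ⊆ L, Odd S.card →
      ∑ i ∈ S, ((1 - 6 * ε) * lam i + 3 * ε)
          - ∑ i ∈ L \ S, ((1 - 6 * ε) * lam i + 3 * ε)
        ≤ (S.card : ℝ) - 1) := by
  refine ⟨fun i => ?_, fun S hS hodd => ?_⟩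
  · obtain ⟨h0, h1⟩ := hlam i
    constructor <;> nlinarith
  · have h := hloc S hS hodd
    have hA : ∑ i ∈ S, lam i ≤ ∑ i ∈ S, (mu i + ε) :=
      Finset.sum_le_sum fun i _ => by
        have := (abs_le.mp (hmu i)).1
        linarith
    have hB : ∑ i ∈ L \ S, mu i ≤ ∑ i ∈ L \ S, (lam i + ε) :=
      Finset.sum_le_sum fun i _ => by
        have := (abs_le.mp (hmu i)).2
        linarith
    have hc : ((L \ S).card : ℝ) + (S.card : ℝ) = (L.card : ℝ) := by
      exact_mod_cast Finset.card_sdiff_add_card_eq_card hS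
    have hn : (3 : ℝ) ≤ (L.card : ℝ) := by exact_mod_cast hL
    simp only [Finset.sum_add_distrib, Finset.sum_const, nsmul_eq_mul, ← Finset.mul_sum]
      at hA hB ⊢
    generalize ∑ i ∈ S, lam i = a at *
    generalize ∑ i ∈ L \ S, lam i = b at *
    generalize ((L \ S).card : ℝ) = t at *
    generalize (S.card : ℝ) = s at *
    generalize (L.card : ℝ) = n at *
    have hX : a - b ≤ s - 1 + n * ε := by
      rw [← hc]; linarith
    have h1 := mul_le_mul_of_nonneg_left hX (by linarith : (0 : ℝ) ≤ 1 - 6 * ε)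
    have h2 : 0 ≤ ε * (n - 3) := mul_nonneg hε0 (by linarith)
    have h3 : 0 ≤ n * (ε * ε) := mul_nonneg (by linarith) (mul_nonneg hε0 hε0)
    subst hc
    nlinarith
end

section
/- Let 𝒮 be a finite state set and E a finite edge set with maps s, s' : E → 𝒮 such that {e : s'(e) = k} is nonempty for every k ∈ 𝒮. Let K > 0, Γ : E → ℝ, and n : 𝒮 → ℝ, and define n' : 𝒮 → ℝ by the softened forward recursion n'(k) = (1/K)·ln( Σ_{e : s'(e)=k} exp( K·n(s(e)) − K·Γ_e ) ). Set λ_e = exp(−K Γ_e), α(k) = exp(K n(k)) / Σ_{k'∈𝒮} exp(K n(k')), and α'(k) = exp(K n'(k)) / Σ_{k'∈𝒮} exp(K n'(k')). Then for every k ∈ 𝒮, α'(k) = ( Σ_{e : s'(e)=k} α(s(e))·λ_e ) / ( Σ_{k'∈𝒮} Σ_{e : s'(e)=k'} α(s(e))·λ_e ). -/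
/-- under the exponential change of variables `α(k) ∝ e^{K n(k)}`,
`λ_e = e^{−K Γ_e}`, the softened (log-sum-exp) forward recursion becomes the
normalized BCJR forward recursion. -/
theorem stmt_19 {S E : Type*} [Fintype S] [DecidableEq S] [Fintype E]
    (s s' : E → S)
    (hne : ∀ k : S, (Finset.univ.filter (fun e => s' e = k)).Nonempty)
    (K : ℝ) (hK : 0 < K) (Γ : E → ℝ) (n n' : S → ℝ)
    (hn' : ∀ k, n' k = (1 / K) * Real.log
      (∑ e ∈ Finset.univ.filter (fun e => s' e = k),
        Real.exp (K * n (s e) - K * Γ e)))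
    (lam : E → ℝ) (hlam : ∀ e, lam e = Real.exp (-K * Γ e))
    (α α' : S → ℝ)
    (hα : ∀ k, α k = Real.exp (K * n k) / ∑ k' : S, Real.exp (K * n k'))
    (hα' : ∀ k, α' k = Real.exp (K * n' k) / ∑ k' : S, Real.exp (K * n' k')) :
    ∀ k, α' k
      = (∑ e ∈ Finset.univ.filter (fun e => s' e = k), α (s e) * lam e)
        / (∑ k' : S, ∑ e ∈ Finset.univ.filter (fun e => s' e = k'), α (s e) * lam e) := by
  intro k
  have hZ : 0 < ∑ k' : S, Real.exp (K * n k') :=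
    Finset.sum_pos (fun _ _ => Real.exp_pos _) ⟨k, Finset.mem_univ k⟩
  have h1 : ∀ j, Real.exp (K * n' j) = ∑ e ∈ Finset.univ.filter (fun e => s' e = j),
      Real.exp (K * n (s e) - K * Γ e) := by
    intro j
    have hp : 0 < ∑ e ∈ Finset.univ.filter (fun e => s' e = j),
        Real.exp (K * n (s e) - K * Γ e) :=
      Finset.sum_pos (fun _ _ => Real.exp_pos _) (hne j)
    rw [hn' j, ← mul_assoc, mul_one_div_cancel hK.ne', one_mul, Real.exp_log hp]
  have h2 : ∀ j, ∑ e ∈ Finset.univ.filter (fun e => s' e = j), α (s e) * lam e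
      = Real.exp (K * n' j) / ∑ k' : S, Real.exp (K * n k') := by
    intro j
    rw [h1 j, Finset.sum_div]
    refine Finset.sum_congr rfl fun e _ => ?_
    rw [hα, hlam, div_mul_eq_mul_div, ← Real.exp_add]
    congr 2
    ring
  simp only [h2]
  rw [← Finset.sum_div, div_div_div_cancel_right₀ hZ.ne', hα' k]
end
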